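/- arXiv:1607.03315 — 3 statements merged into one kernel-verified Lean document; each statement's English description precedes it below -/
import Mathlib

section
/- Let G be an infinite group, F a division ring, and V an F-vector space whose dimension (as a cardinal) is at least the cardinality of G. Then there exists a faithful fixed point free representation of G on V; that is, an injective group homomorphism ρ from G into the group of F-linear automorphisms of V such that the only vector v ∈ V with ρ(g)(v) = v for all g ∈ G is v = 0. -/
universe u v w

/-- The left translation action of `G` on the second factor of a basis indexed by `I × G`,
extended linearly. -/
noncomputable def Module.Basis.leftTranslation {G I F V : Type*} [Group G] [DivisionRing F]
    [AddCommGroup V] [Module F V] (b : Module.Basis (I × G) F V) : G →* (V ≃ₗ[F] V) :=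
  MonoidHom.mk' (fun g => b.equiv b ((Equiv.refl I).prodCongr (Equiv.mulLeft g))) fun g h =>
    LinearEquiv.toLinearMap_injective <| b.ext fun x => by simp [Prod.map]

@[simp]
theorem Module.Basis.leftTranslation_apply {G I F V : Type*} [Group G] [DivisionRing F]
    [AddCommGroup V] [Module F V] (b : Module.Basis (I × G) F V) (g : G) (x : I × G) :
    b.leftTranslation g (b x) = b (x.1, g * x.2) := by
  simp [Module.Basis.leftTranslation, Prod.map]

theorem Module.Basis.leftTranslation_injective {G I F V : Type*} [Group G] [DivisionRing F]
    [AddCommGroup V] [Module F V] [Nonempty I] (b : Module.Basis (I × G) F V) :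
    Function.Injective b.leftTranslation := by
  intro g h hgh
  obtain ⟨i⟩ := ‹Nonempty I›
  have key := LinearEquiv.congr_fun hgh (b (i, 1))
  rw [b.leftTranslation_apply, b.leftTranslation_apply] at key
  simpa using congrArg Prod.snd (b.injective key)

theorem Module.Basis.repr_leftTranslation {G I F V : Type*} [Group G] [DivisionRing F]
    [AddCommGroup V] [Module F V] (b : Module.Basis (I × G) F V) (g : G) (v : V) (x : I × G) :
    b.repr (b.leftTranslation g v) (x.1, g * x.2) = b.repr v x := by
  classical
  suffices h : Finsupp.lapply (R := F) (x.1, g * x.2) ∘ₗ b.repr.toLinearMap ∘ₗ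
      (b.leftTranslation g).toLinearMap = Finsupp.lapply x ∘ₗ b.repr.toLinearMap from
    LinearMap.congr_fun h v
  refine b.ext fun y => ?_
  simp [Finsupp.single_apply, Prod.ext_iff]

theorem Module.Basis.eq_zero_of_leftTranslation_fixed {G I F V : Type*} [Group G] [Infinite G]
    [DivisionRing F] [AddCommGroup V] [Module F V] (b : Module.Basis (I × G) F V) (v : V)
    (hv : ∀ g : G, b.leftTranslation g v = v) : v = 0 := by
  by_contra hne
  obtain ⟨x, hx⟩ := Finsupp.ne_iff.mp (b.repr.map_ne_zero_iff.mpr hne)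
  have hmem (g : G) : (x.1, g * x.2) ∈ (b.repr v).support := by
    rw [Finsupp.mem_support_iff]
    have := b.repr_leftTranslation g v x
    rw [hv] at this
    rwa [this]
  refine Set.infinite_of_injective_forall_mem (f := fun g : G => (x.1, g * x.2)) ?_ hmem
    (b.repr v).support.finite_toSet
  intro g h hgh
  simpa using hgh

/-- Let `G` be an infinite group, `F` a division ring, and `V`
an `F`-vector space whose dimension (as a cardinal) is at least the cardinality
of `G`.  Then there exists a faithful fixed point free representation of `G` on
`V`: an injective group homomorphism from `G` into the group of `F`-linear
automorphisms of `V` whose only common fixed vector is `0`. -/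
theorem infinite_group_faithful_fixedPointFree_rep
    (G : Type u) [Group G] [Infinite G]
    (F : Type v) [DivisionRing F]
    (V : Type w) [AddCommGroup V] [Module F V]
    (hdim : Cardinal.lift.{w} (Cardinal.mk G) ≤ Cardinal.lift.{u} (Module.rank F V)) :
    ∃ ρ : G →* (V ≃ₗ[F] V), Function.Injective ρ ∧
      ∀ v : V, (∀ g : G, ρ g v = v) → v = 0 := by
  have hI : Cardinal.lift.{w} (Cardinal.mk G) ≤
      Cardinal.lift.{u} (Cardinal.mk (Module.Free.ChooseBasisIndex F V)) := by
    rwa [← Module.Free.rank_eq_card_chooseBasisIndex]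
  have hG : Cardinal.aleph0 ≤ Cardinal.lift.{w} (Cardinal.mk G) := by simp
  have hcard : Cardinal.mk (Module.Free.ChooseBasisIndex F V × G) =
      Cardinal.mk (ULift.{u} (Module.Free.ChooseBasisIndex F V)) := by
    rw [Cardinal.mk_prod, Cardinal.mk_uLift]
    exact Cardinal.mul_eq_left (hG.trans hI) hI (by simp)
  obtain ⟨e⟩ := Cardinal.eq.mp hcard
  have : Nonempty (Module.Free.ChooseBasisIndex F V) := by
    rw [← Cardinal.mk_ne_zero_iff, Ne, ← Cardinal.lift_eq_zero.{u, w}]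
    exact (Cardinal.aleph0_pos.trans_le (hG.trans hI)).ne'
  let b := (Module.Free.chooseBasis F V).reindex (e.trans Equiv.ulift).symm
  exact ⟨b.leftTranslation, b.leftTranslation_injective, b.eq_zero_of_leftTranslation_fixed⟩
end

section
/- Let L be a bounded modular lattice and ā a 4-frame of L (so a_⊥ = ⊥ and a_⊤ = ⊤). Then the set G(L,ā) = {g ∈ L : g ⊔ a₁ = g ⊔ a₂ = a₁ ⊔ a₂ and g ⊓ a₁ = g ⊓ a₂ = ⊥} is a group under the multiplication (g, h) ↦ t(g, h, ā), with neutral element a_{12}: the operation maps G(L,ā) × G(L,ā) into G(L,ā), is associative on G(L,ā), a_{12} is a two-sided identity, and every element of G(L,ā) has a two-sided inverse in G(L,ā). -/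
variable {L : Type*} [Lattice L] {n : ℕ}

/-- The join `∑_{i ∈ I} a i`, where the empty join is `bot`. -/
def frameSum (bot : L) (a : Fin n → L) (I : Finset (Fin n)) : L :=
  I.fold (· ⊔ ·) bot a

/-- An `n`-frame in a lattice `L`: elements `a i` (`i < n`), `e i j = a_{ij}`,
with bottom `bot = a_⊥` and top `top = a_⊤`.  An `n`-frame *of* a bounded
lattice is an `n`-frame with `bot = ⊥` and `top = ⊤`. -/
structure IsFrame (bot top : L) (a : Fin n → L) (e : Fin n → Fin n → L) : Prop where
  symm : ∀ i j : Fin n, e i j = e j i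
  inf_sum : ∀ I J : Finset (Fin n),
    frameSum bot a I ⊓ frameSum bot a J = frameSum bot a (I ∩ J)
  top_def : top = frameSum bot a Finset.univ
  sup_e : ∀ i j : Fin n, i ≠ j → a i ⊔ a j = a i ⊔ e i j
  inf_e : ∀ i j : Fin n, i ≠ j → a i ⊓ e i j = bot
  trans_e : ∀ i j k : Fin n, i ≠ j → j ≠ k → i ≠ k →
    e i k = (a i ⊔ a k) ⊓ (e i j ⊔ e j k)

/-- `G(L,ā) = {g : g ⊔ a₁ = g ⊔ a₂ = a₁ ⊔ a₂, g ⊓ a₁ = g ⊓ a₂ = ⊥}`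
(indices shifted: `a₁ = a 0`, `a₂ = a 1`). -/
def frameG [BoundedOrder L] (a : Fin 4 → L) : Set L :=
  {g | g ⊔ a 0 = a 0 ⊔ a 1 ∧ g ⊔ a 1 = a 0 ⊔ a 1 ∧ g ⊓ a 0 = ⊥ ∧ g ⊓ a 1 = ⊥}

/-- The lattice term
`t(x,y,ā) = (((y ⊔ ((((x ⊔ a₂₃) ⊓ (a₁ ⊔ a₃)) ⊔ a₁₂) ⊓ (a₂ ⊔ a₃))) ⊓ (a₁ ⊔ a₃)) ⊔ a₂₃) ⊓ (a₁ ⊔ a₂)`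
(indices shifted: `a₁ = a 0`, `a₂ = a 1`, `a₃ = a 2`, `a_{ij} = e (i-1) (j-1)`). -/
def frameMul (a : Fin 4 → L) (e : Fin 4 → Fin 4 → L) (x y : L) : L :=
  (((y ⊔ ((((x ⊔ e 1 2) ⊓ (a 0 ⊔ a 2)) ⊔ e 0 1) ⊓ (a 1 ⊔ a 2))) ⊓ (a 0 ⊔ a 2)) ⊔ e 1 2)
    ⊓ (a 0 ⊔ a 1)

/-- The composite `(x ⊔ y) ⊓ (a i ⊔ a k)` of `x` (from `a i` to `a j`) and `y` (from `a j` to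
`a k`). -/
def frameComp (a : Fin n → L) (i k : Fin n) (x y : L) : L :=
  (x ⊔ y) ⊓ (a i ⊔ a k)

/-- `x` is a common complement of `a i` and `a j` in the interval `[⊥, a i ⊔ a j]`. -/
structure IsFrameAxis [BoundedOrder L] (a : Fin n → L) (i j : Fin n) (x : L) : Prop where
  sup_left : x ⊔ a i = a i ⊔ a j
  sup_right : x ⊔ a j = a i ⊔ a j
  inf_left : x ⊓ a i = ⊥
  inf_right : x ⊓ a j = ⊥

theorem frameComp_symm (a : Fin n → L) (i k : Fin n) (x y : L) :
    frameComp a i k x y = frameComp a k i y x := by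
  simp only [frameComp, sup_comm]

namespace IsFrameAxis

variable [BoundedOrder L] {a : Fin n → L} {i j : Fin n} {x : L}

theorem symm (hx : IsFrameAxis a i j x) : IsFrameAxis a j i x :=
  ⟨hx.2.trans (sup_comm _ _), hx.1.trans (sup_comm _ _), hx.4, hx.3⟩

theorem le (hx : IsFrameAxis a i j x) : x ≤ a i ⊔ a j :=
  le_sup_left.trans hx.sup_left.le

end IsFrameAxis

theorem mem_frameG_iff [BoundedOrder L] {a : Fin 4 → L} {g : L} :
    g ∈ frameG a ↔ IsFrameAxis a 0 1 g :=
  ⟨fun h => ⟨h.1, h.2.1, h.2.2.1, h.2.2.2⟩, fun h => ⟨h.1, h.2, h.3, h.4⟩⟩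

namespace IsFrame

section Basic

variable [BoundedOrder L] {a : Fin n → L} {e : Fin n → Fin n → L} {i j k l : Fin n} {x y z : L}

theorem isFrameAxis (hf : IsFrame (⊥ : L) ⊤ a e) (hij : i ≠ j) : IsFrameAxis a i j (e i j) where
  sup_left := by rw [hf.sup_e i j hij, sup_comm]
  sup_right := by rw [sup_comm (a i), hf.sup_e j i hij.symm, hf.symm j i, sup_comm]
  inf_left := by rw [inf_comm, hf.inf_e i j hij]
  inf_right := by rw [inf_comm, hf.symm i j, hf.inf_e j i hij.symm]

theorem frameComp_e (hf : IsFrame (⊥ : L) ⊤ a e) (hij : i ≠ j) (hjk : j ≠ k) (hik : i ≠ k) :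
    frameComp a i k (e i j) (e j k) = e i k := by
  rw [frameComp, inf_comm, ← hf.trans_e i j k hij hjk hik]

theorem sup_inf_sup (hf : IsFrame (⊥ : L) ⊤ a e) (I J : Finset (Fin n)) :
    I.sup a ⊓ J.sup a = (I ∩ J).sup a :=
  hf.inf_sum I J

theorem pair_inf_pair (hf : IsFrame (⊥ : L) ⊤ a e) (hik : i ≠ k) :
    (a i ⊔ a j) ⊓ (a j ⊔ a k) = a j := by
  have h := hf.sup_inf_sup {i, j} {j, k}
  have hI : ({i, j} ∩ {j, k} : Finset (Fin n)) = {j} := by grind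
  simpa [hI] using h

theorem triple_inf_triple (hf : IsFrame (⊥ : L) ⊤ a e) (hjl : j ≠ l) :
    (a i ⊔ a j ⊔ a k) ⊓ (a i ⊔ a k ⊔ a l) = a i ⊔ a k := by
  have h := hf.sup_inf_sup {i, j, k} {i, k, l}
  have hI : ({i, j, k} ∩ {i, k, l} : Finset (Fin n)) = {i, k} := by grind
  simpa [hI, sup_assoc] using h

variable [IsModularLattice L]

theorem sup_inf_pair (hf : IsFrame (⊥ : L) ⊤ a e) (hik : i ≠ k)
    (hx : IsFrameAxis a i j x) (hy : IsFrameAxis a j k y) : (x ⊔ y) ⊓ (a i ⊔ a j) = x := by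
  have h : y ⊓ (a i ⊔ a j) = ⊥ := by
    rw [← inf_eq_left.2 hy.le, inf_assoc, inf_comm (a j ⊔ a k), hf.pair_inf_pair hik,
      hy.inf_left]
  rw [sup_inf_assoc_of_le y hx.le, h, sup_bot_eq]

theorem frameComp_sup_left (hx : IsFrameAxis a i j x) (hy : IsFrameAxis a j k y) :
    frameComp a i k x y ⊔ a i = a i ⊔ a k := by
  have h : a i ⊔ a k ≤ x ⊔ y ⊔ a i := by
    have : x ⊔ y ⊔ a i = a i ⊔ (a j ⊔ a k) := by
      rw [sup_right_comm, hx.sup_left, sup_assoc, sup_comm (a j), hy.sup_left]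
    rw [this]
    exact sup_le_sup_left le_sup_right _
  rw [frameComp, inf_comm, inf_sup_assoc_of_le (x ⊔ y) (le_sup_left : a i ≤ a i ⊔ a k),
    inf_eq_left.2 h]

theorem frameComp_inf_left (hf : IsFrame (⊥ : L) ⊤ a e) (hik : i ≠ k)
    (hx : IsFrameAxis a i j x) (hy : IsFrameAxis a j k y) :
    frameComp a i k x y ⊓ a i = ⊥ := by
  have h : (x ⊔ y) ⊓ a i = ⊥ := by
    rw [← hx.inf_left, ← hf.sup_inf_pair hik hx hy, inf_assoc (x ⊔ y) (a i ⊔ a j),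
      inf_eq_right.2 (le_sup_left : a i ≤ a i ⊔ a j), hf.sup_inf_pair hik hx hy]
  rw [frameComp, inf_assoc, inf_eq_right.2 (le_sup_left : a i ≤ a i ⊔ a k), h]

theorem isFrameAxis_frameComp (hf : IsFrame (⊥ : L) ⊤ a e) (hik : i ≠ k)
    (hx : IsFrameAxis a i j x) (hy : IsFrameAxis a j k y) :
    IsFrameAxis a i k (frameComp a i k x y) where
  sup_left := frameComp_sup_left hx hy
  sup_right := by
    rw [frameComp_symm, frameComp_sup_left hy.symm hx.symm, sup_comm]
  inf_left := hf.frameComp_inf_left hik hx hy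
  inf_right := by
    rw [frameComp_symm, hf.frameComp_inf_left hik.symm hy.symm hx.symm]

theorem frameComp_cancel_right (hf : IsFrame (⊥ : L) ⊤ a e) (hik : i ≠ k)
    (hx : IsFrameAxis a i j x) (hy : IsFrameAxis a j k y) :
    frameComp a i j (frameComp a i k x y) y = x := by
  have h : a i ⊔ a j ≤ a i ⊔ a k ⊔ y := by
    rw [sup_assoc, sup_comm (a k), hy.sup_right]
    exact sup_le_sup_left le_sup_left _
  rw [frameComp, frameComp, inf_sup_assoc_of_le _ (le_sup_right : y ≤ x ⊔ y), inf_assoc,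
    inf_eq_right.2 h, hf.sup_inf_pair hik hx hy]

theorem frameComp_cancel_left (hf : IsFrame (⊥ : L) ⊤ a e) (hik : i ≠ k)
    (hx : IsFrameAxis a i j x) (hy : IsFrameAxis a j k y) :
    frameComp a j k x (frameComp a i k x y) = y := by
  rw [frameComp_symm a j, frameComp_symm a i,
    hf.frameComp_cancel_right hik.symm hy.symm hx.symm]

theorem frameComp_frameComp_eq_sup (hf : IsFrame (⊥ : L) ⊤ a e) (hjl : j ≠ l)
    (hx : IsFrameAxis a i j x) (hy : IsFrameAxis a j k y) (hz : IsFrameAxis a k l z) :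
    frameComp a i l (frameComp a i k x y) z = (x ⊔ y ⊔ z) ⊓ (a i ⊔ a l) := by
  have hxy : x ⊔ y ≤ a i ⊔ a j ⊔ a k :=
    sup_le (hx.le.trans le_sup_left)
      (hy.le.trans (sup_le (le_sup_right.trans le_sup_left) le_sup_right))
  have hzle : z ≤ a i ⊔ a k ⊔ a l :=
    hz.le.trans (sup_le (le_sup_right.trans le_sup_left) le_sup_right)
  have hil' : a i ⊔ a l ≤ a i ⊔ a k ⊔ a l := sup_le_sup_right le_sup_left _
  have h : (x ⊔ y) ⊓ (a i ⊔ a k) = (x ⊔ y) ⊓ (a i ⊔ a k ⊔ a l) := by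
    conv_lhs => rw [← hf.triple_inf_triple hjl, ← inf_assoc, inf_eq_left.2 hxy]
  rw [frameComp, frameComp, h, inf_comm (x ⊔ y), inf_sup_assoc_of_le _ hzle, inf_comm,
    ← inf_assoc, inf_eq_left.2 hil', inf_comm]

theorem frameComp_assoc (hf : IsFrame (⊥ : L) ⊤ a e) (hik : i ≠ k) (hjl : j ≠ l)
    (hx : IsFrameAxis a i j x) (hy : IsFrameAxis a j k y) (hz : IsFrameAxis a k l z) :
    frameComp a i l (frameComp a i k x y) z = frameComp a i l x (frameComp a j l y z) := by
  rw [hf.frameComp_frameComp_eq_sup hjl hx hy hz, frameComp_symm a i l x,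
    frameComp_symm a j l, hf.frameComp_frameComp_eq_sup hik.symm hz.symm hy.symm hx.symm]
  congr 1
  · rw [sup_comm z, sup_comm _ x, sup_assoc]
  · exact sup_comm _ _

end Basic

section Group

variable [BoundedOrder L] {a : Fin 4 → L} {e : Fin 4 → Fin 4 → L} {g h k : L}

/-- The transport of `x` from the axes `a 0`, `a 1` to the axes `a 1`, `a 2`. -/
def shift (a : Fin 4 → L) (e : Fin 4 → Fin 4 → L) (x : L) : L :=
  frameComp a 1 2 (e 1 0) (frameComp a 0 2 x (e 1 2))

theorem frameMul_eq (hf : IsFrame (⊥ : L) ⊤ a e) (x y : L) :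
    frameMul a e x y = frameComp a 0 1 (frameComp a 0 2 y (shift a e x)) (e 1 2) := by
  rw [shift, frameComp_symm a 1 2, frameComp_symm a 2 1, hf.symm 1 0]
  simp only [frameMul, frameComp, sup_comm (e 0 1)]

variable [IsModularLattice L]

theorem isFrameAxis_shift (hf : IsFrame (⊥ : L) ⊤ a e) (hg : IsFrameAxis a 0 1 g) :
    IsFrameAxis a 1 2 (shift a e g) :=
  hf.isFrameAxis_frameComp (by decide) (hf.isFrameAxis (by decide))
    (hf.isFrameAxis_frameComp (by decide) hg (hf.isFrameAxis (by decide)))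

theorem isFrameAxis_frameMul (hf : IsFrame (⊥ : L) ⊤ a e) (hg : IsFrameAxis a 0 1 g)
    (hh : IsFrameAxis a 0 1 h) : IsFrameAxis a 0 1 (frameMul a e g h) := by
  rw [hf.frameMul_eq]
  exact hf.isFrameAxis_frameComp (by decide)
    (hf.isFrameAxis_frameComp (by decide) hh (hf.isFrameAxis_shift hg))
    (hf.isFrameAxis (by decide)).symm

/-- Transporting a product to the axes `a 0`, `a 2` undoes the last step of `frameMul`. -/
theorem frameComp_frameMul (hf : IsFrame (⊥ : L) ⊤ a e) (hg : IsFrameAxis a 0 1 g)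
    (hh : IsFrameAxis a 0 1 h) :
    frameComp a 0 2 (frameMul a e g h) (e 1 2) = frameComp a 0 2 h (shift a e g) := by
  rw [hf.frameMul_eq]
  exact hf.frameComp_cancel_right (by decide)
    (hf.isFrameAxis_frameComp (by decide) hh (hf.isFrameAxis_shift hg))
    (hf.isFrameAxis (by decide)).symm

/-- Composing the transport of `h` with an element `z` reaching the fourth axis. -/
theorem frameComp_shift (hf : IsFrame (⊥ : L) ⊤ a e) {z : L} (hh : IsFrameAxis a 0 1 h)
    (hz : IsFrameAxis a 2 3 z) :
    frameComp a 1 3 (shift a e h) z =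
      frameComp a 1 3 (e 1 0) (frameComp a 0 3 h (frameComp a 1 3 (e 1 2) z)) := by
  have h12 : IsFrameAxis a 1 2 (e 1 2) := hf.isFrameAxis (by decide)
  rw [shift, hf.frameComp_assoc (by decide) (by decide) (hf.isFrameAxis (by decide))
    (hf.isFrameAxis_frameComp (by decide) hh h12) hz,
    hf.frameComp_assoc (by decide) (by decide) hh h12 hz]

theorem frameMul_assoc (hf : IsFrame (⊥ : L) ⊤ a e) (hg : IsFrameAxis a 0 1 g)
    (hh : IsFrameAxis a 0 1 h) (hk : IsFrameAxis a 0 1 k) :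
    frameMul a e (frameMul a e g h) k = frameMul a e g (frameMul a e h k) := by
  have h12 : IsFrameAxis a 1 2 (e 1 2) := hf.isFrameAxis (by decide)
  have h10 : IsFrameAxis a 1 0 (e 1 0) := hf.isFrameAxis (by decide)
  have h23 : IsFrameAxis a 2 3 (e 2 3) := hf.isFrameAxis (by decide)
  have hsg := hf.isFrameAxis_shift hg
  have hsh := hf.isFrameAxis_shift hh
  have hgh := hf.isFrameAxis_frameMul hg hh
  have hhk := hf.isFrameAxis_frameMul hh hk
  have hsgh := hf.isFrameAxis_shift hgh
  have hhsg : IsFrameAxis a 0 2 (frameComp a 0 2 h (shift a e g)) :=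
    hf.isFrameAxis_frameComp (by decide) hh hsg
  have hg13 : IsFrameAxis a 1 3 (frameComp a 1 3 (shift a e g) (e 2 3)) :=
    hf.isFrameAxis_frameComp (by decide) hsg h23
  obtain ⟨z, hz, hgz⟩ : ∃ z, IsFrameAxis a 2 3 z ∧
      frameComp a 1 3 (e 1 2) z = frameComp a 1 3 (shift a e g) (e 2 3) :=
    ⟨_, hf.isFrameAxis_frameComp (by decide) h12.symm hg13,
      hf.frameComp_cancel_left (by decide) h12.symm hg13⟩
  have key : frameComp a 1 3 (shift a e (frameMul a e g h)) (e 2 3) =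
      frameComp a 1 3 (shift a e h) z := by
    rw [hf.frameComp_shift hh hz, hgz, shift, hf.frameComp_frameMul hg hh,
      hf.frameComp_assoc (by decide) (by decide) h10 hhsg h23,
      hf.frameComp_assoc (by decide) (by decide) hh hsg h23]
  have hcomp : frameComp a 0 3 (frameComp a 0 2 k (shift a e (frameMul a e g h))) (e 2 3) =
      frameComp a 0 3 (frameComp a 0 2 (frameMul a e h k) (shift a e g)) (e 2 3) := by
    rw [hf.frameComp_assoc (by decide) (by decide) hk hsgh h23,
      hf.frameComp_assoc (by decide) (by decide) hhk hsg h23, key, ← hgz,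
      ← hf.frameComp_assoc (by decide) (by decide) hhk h12 hz, hf.frameComp_frameMul hh hk,
      hf.frameComp_assoc (by decide) (by decide) hk hsh hz]
  have hcancel : ∀ {w : L}, IsFrameAxis a 0 2 w →
      frameComp a 0 2 (frameComp a 0 3 w (e 2 3)) (e 2 3) = w := fun hw =>
    hf.frameComp_cancel_right (by decide) hw h23
  rw [hf.frameMul_eq (frameMul a e g h), hf.frameMul_eq g (frameMul a e h k),
    ← hcancel (hf.isFrameAxis_frameComp (by decide) hk hsgh), hcomp,
    hcancel (hf.isFrameAxis_frameComp (by decide) hhk hsg)]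

theorem frameMul_one (hf : IsFrame (⊥ : L) ⊤ a e) (hg : IsFrameAxis a 0 1 g) :
    frameMul a e g (e 0 1) = g := by
  have h12 : IsFrameAxis a 1 2 (e 1 2) := hf.isFrameAxis (by decide)
  rw [hf.frameMul_eq, shift, hf.symm 0 1,
    hf.frameComp_cancel_left (by decide) (hf.isFrameAxis (by decide))
      (hf.isFrameAxis_frameComp (by decide) hg h12),
    hf.frameComp_cancel_right (by decide) hg h12]

theorem one_frameMul (hf : IsFrame (⊥ : L) ⊤ a e) (hg : IsFrameAxis a 0 1 g) :
    frameMul a e (e 0 1) g = g := by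
  rw [hf.frameMul_eq, shift, hf.frameComp_e (by decide) (by decide) (by decide),
    hf.frameComp_e (by decide) (by decide) (by decide),
    hf.frameComp_cancel_right (by decide) hg (hf.isFrameAxis (by decide))]

theorem exists_frameMul_eq_one (hf : IsFrame (⊥ : L) ⊤ a e) (hg : IsFrameAxis a 0 1 g) :
    ∃ h, IsFrameAxis a 0 1 h ∧ frameMul a e g h = e 0 1 := by
  have h02 : IsFrameAxis a 0 2 (e 0 2) := hf.isFrameAxis (by decide)
  have hsg := (hf.isFrameAxis_shift hg).symm
  refine ⟨frameComp a 0 1 (e 0 2) (shift a e g),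
    hf.isFrameAxis_frameComp (by decide) h02 hsg, ?_⟩
  rw [hf.frameMul_eq, hf.frameComp_cancel_right (by decide) h02 hsg,
    hf.symm 1 2, hf.frameComp_e (by decide) (by decide) (by decide)]

theorem exists_inverse (hf : IsFrame (⊥ : L) ⊤ a e) (hg : IsFrameAxis a 0 1 g) :
    ∃ h, IsFrameAxis a 0 1 h ∧ frameMul a e g h = e 0 1 ∧ frameMul a e h g = e 0 1 := by
  obtain ⟨h, hh, hgh⟩ := hf.exists_frameMul_eq_one hg
  obtain ⟨k, hk, hhk⟩ := hf.exists_frameMul_eq_one hh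
  have hkg : k = g := by
    rw [← hf.one_frameMul hk, ← hgh, hf.frameMul_assoc hg hh hk, hhk, hf.frameMul_one hg]
  exact ⟨h, hh, hgh, hkg ▸ hhk⟩

end Group

end IsFrame

/-- For a 4-frame `ā` of a bounded modular lattice `L`, the set
`G(L,ā)` is a group under `(g,h) ↦ t(g,h,ā)` with neutral element `a₁₂`. -/
theorem frameG_group [BoundedOrder L] [IsModularLattice L]
    (a : Fin 4 → L) (e : Fin 4 → Fin 4 → L) (hf : IsFrame (⊥ : L) ⊤ a e) :
    (∀ g ∈ frameG a, ∀ h ∈ frameG a, frameMul a e g h ∈ frameG a) ∧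
    (∀ g ∈ frameG a, ∀ h ∈ frameG a, ∀ k ∈ frameG a,
      frameMul a e (frameMul a e g h) k = frameMul a e g (frameMul a e h k)) ∧
    e 0 1 ∈ frameG a ∧
    (∀ g ∈ frameG a, frameMul a e g (e 0 1) = g ∧ frameMul a e (e 0 1) g = g) ∧
    (∀ g ∈ frameG a, ∃ h ∈ frameG a,
      frameMul a e g h = e 0 1 ∧ frameMul a e h g = e 0 1) := by
  simp only [mem_frameG_iff]
  exact ⟨fun _ hg _ hh => hf.isFrameAxis_frameMul hg hh,
    fun _ hg _ hh _ hk => hf.frameMul_assoc hg hh hk, hf.isFrameAxis (by decide),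
    fun _ hg => ⟨hf.frameMul_one hg, hf.one_frameMul hg⟩, fun _ hg => hf.exists_inverse hg⟩
end

section
/- The consistency problem for the class of all finite modular lattices is unsolvable: the set of conjunctions of lattice equations that admit a non-trivial satisfying assignment in some finite modular lattice is not decidable (there is no algorithm which, given a conjunction of lattice equations, decides whether some finite modular lattice contains elements not all equal that satisfy all its equations). -/
/-- Lattice terms in countably many variables. -/
inductive LatTerm : Type where
  | var : ℕ → LatTerm
  | sup : LatTerm → LatTerm → LatTerm
  | inf : LatTerm → LatTerm → LatTerm

/-- Evaluation of a lattice term under an assignment `v`. -/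
def LatTerm.eval {L : Type*} [Lattice L] (v : ℕ → L) : LatTerm → L
  | .var i => v i
  | .sup s t => s.eval v ⊔ t.eval v
  | .inf s t => s.eval v ⊓ t.eval v

/-- The variables occurring in a lattice term. -/
def LatTerm.vars : LatTerm → Finset ℕ
  | .var i => {i}
  | .sup s t => s.vars ∪ t.vars
  | .inf s t => s.vars ∪ t.vars

/-- An injective Gödel numbering of lattice terms. -/
def LatTerm.code : LatTerm → ℕ
  | .var i => 3 * i
  | .sup s t => 3 * Nat.pair s.code t.code + 1
  | .inf s t => 3 * Nat.pair s.code t.code + 2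

/-- A conjunction of lattice equations `s = t`, as a finite list of pairs. -/
abbrev LatConj : Type := List (LatTerm × LatTerm)

/-- The variables occurring in a conjunction of lattice equations. -/
def LatConj.vars (Φ : LatConj) : Finset ℕ :=
  Φ.foldr (fun p s => p.1.vars ∪ p.2.vars ∪ s) ∅

/-- A (natural) Gödel numbering of conjunctions of lattice equations. -/
def LatConj.code (Φ : LatConj) : ℕ :=
  Encodable.encode (Φ.map fun p => Nat.pair p.1.code p.2.code)

/-- `Φ` is satisfied by the assignment `v`. -/
def LatConj.Sat {L : Type*} [Lattice L] (Φ : LatConj) (v : ℕ → L) : Prop :=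
  ∀ p ∈ Φ, p.1.eval v = p.2.eval v

/-- The assignment `v` is non-trivial for `Φ`: not all (occurring) variables get
the same value. -/
def LatConj.Nontriv {L : Type*} (Φ : LatConj) (v : ℕ → L) : Prop :=
  ∃ i ∈ Φ.vars, ∃ j ∈ Φ.vars, v i ≠ v j

namespace ModularConsistency

section Perspectivity

variable {L : Type*} [Lattice L] [IsModularLattice L]

theorem perspectivity_cancel {o a b d u : L} (hda : d ⊔ a = a ⊔ b) (hdb : d ⊔ b = a ⊔ b)
    (hd : d ⊓ a = o) (hou : o ≤ u) (hua : u ≤ a) :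
    (((u ⊔ d) ⊓ b) ⊔ d) ⊓ a = u := by
  have hud : u ⊔ d ≤ a ⊔ b := sup_le (hua.trans le_sup_left) (hda ▸ le_sup_left)
  rw [inf_sup_assoc_of_le b (le_sup_right : d ≤ u ⊔ d), sup_comm b d, hdb, inf_eq_left.2 hud,
    sup_inf_assoc_of_le d hua, hd, sup_eq_left.2 hou]

/-- Composition of the relations `s` (from `a` to `b`) and `t` (from `b` to `c`) corresponds to
composition of the induced maps on subobjects. -/
theorem perspectivity_comp {a b c u s t : L} (h : (a ⊔ b) ⊓ c ≤ b) (hu : u ≤ a)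
    (hs : s ≤ a ⊔ b) (ht : t ≤ b ⊔ c) :
    (u ⊔ (s ⊔ t) ⊓ (a ⊔ c)) ⊓ c = (((u ⊔ s) ⊓ b) ⊔ t) ⊓ c := by
  have h₁ : u ⊔ (s ⊔ t) ⊓ (a ⊔ c) = (u ⊔ (s ⊔ t)) ⊓ (a ⊔ c) :=
    (sup_inf_assoc_of_le _ (hu.trans le_sup_left)).symm
  have h₂ : (u ⊔ s) ⊓ (b ⊔ c) = (u ⊔ s) ⊓ b := by
    have hb : (a ⊔ b) ⊓ (b ⊔ c) = b := by
      rw [inf_comm, sup_inf_assoc_of_le c (le_sup_right : b ≤ a ⊔ b), inf_comm, sup_eq_left.2 h]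
    have hus : u ⊔ s ≤ a ⊔ b := sup_le (hu.trans le_sup_left) hs
    calc (u ⊔ s) ⊓ (b ⊔ c) = (u ⊔ s) ⊓ (a ⊔ b) ⊓ (b ⊔ c) := by rw [inf_eq_left.2 hus]
      _ = (u ⊔ s) ⊓ b := by rw [inf_assoc, hb]
  have h₃ : ((u ⊔ s) ⊓ b) ⊔ t = (u ⊔ s ⊔ t) ⊓ (b ⊔ c) := by
    rw [← h₂, sup_comm, sup_comm (u ⊔ s) t, sup_inf_assoc_of_le _ ht]
  rw [h₁, h₃, inf_assoc, inf_assoc, inf_eq_right.2 (le_sup_right : c ≤ a ⊔ c),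
    inf_eq_right.2 (le_sup_right : c ≤ b ⊔ c), sup_assoc]

end Perspectivity

/-- Lattice terms with variables in an arbitrary type. -/
inductive Term (α : Type) : Type
  | var : α → Term α
  | sup : Term α → Term α → Term α
  | inf : Term α → Term α → Term α

namespace Term

variable {α : Type}

instance : Max (Term α) := ⟨sup⟩

instance : Min (Term α) := ⟨inf⟩

/-- Evaluation of a term under an assignment. -/
def eval {L : Type*} [Lattice L] (v : α → L) : Term α → L
  | var i => v i
  | sup s t => s.eval v ⊔ t.eval v
  | inf s t => s.eval v ⊓ t.eval v

section Eval

variable {L : Type*} [Lattice L] (v : α → L)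

@[simp]
theorem eval_var (i : α) : (var i).eval v = v i := rfl

@[simp]
theorem eval_sup (s t : Term α) : (s ⊔ t).eval v = s.eval v ⊔ t.eval v := rfl

end Eval

/-- Renaming of variables into `ℕ`. -/
def toLatTerm (f : α → ℕ) : Term α → LatTerm
  | var i => .var (f i)
  | sup s t => .sup (s.toLatTerm f) (t.toLatTerm f)
  | inf s t => .inf (s.toLatTerm f) (t.toLatTerm f)

theorem eval_toLatTerm {L : Type*} [Lattice L] (f : α → ℕ) (v : ℕ → L) (t : Term α) :
    (t.toLatTerm f).eval v = t.eval (v ∘ f) := by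
  induction t with
  | var i => rfl
  | sup s t hs ht => simp [toLatTerm, LatTerm.eval, eval, hs, ht]
  | inf s t hs ht => simp [toLatTerm, LatTerm.eval, eval, hs, ht]

theorem exists_of_mem_vars_toLatTerm (f : α → ℕ) (t : Term α) {i : ℕ}
    (hi : i ∈ (t.toLatTerm f).vars) : ∃ x, f x = i := by
  induction t with
  | var x => exact ⟨x, by simpa [toLatTerm, LatTerm.vars, eq_comm] using hi⟩
  | sup s t hs ht =>
    rcases Finset.mem_union.1 hi with h | h
    exacts [hs h, ht h]
  | inf s t hs ht =>
    rcases Finset.mem_union.1 hi with h | h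
    exacts [hs h, ht h]

end Term

/-- Names of the operators on the coordinate `a`: the identity, an invertible rotation together
with its inverse and its square, an invertible doubling with its inverse, and for every stack `k`
the removal of a letter from its top (`some x`) or the test for emptiness (`none`). -/
inductive Op (K Γ : Type) : Type
  | one
  | rot
  | rotInv
  | rotSq
  | dbl
  | dblInv
  | stk (k : K) (x : Option Γ)

/-- The variables of the system of equations attached to a stack system. -/
inductive Var (K Γ Q : Type) : Type
  | bot
  | a
  | b
  | c
  | e
  | half
  | goal
  | op (f : Op K Γ)
  | st (q : Q)

/-- The relations `f * g = f' * g'` imposed on the operators. -/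
inductive OpRel {K Γ : Type} : Op K Γ → Op K Γ → Op K Γ → Op K Γ → Prop
  | rot_mul_rotInv : OpRel .rot .rotInv .one .one
  | rotInv_mul_rot : OpRel .rotInv .rot .one .one
  | dbl_mul_dblInv : OpRel .dbl .dblInv .one .one
  | dblInv_mul_dbl : OpRel .dblInv .dbl .one .one
  | rot_mul_rot : OpRel .rot .rot .rotSq .one
  | dbl_mul_rot : OpRel .dbl .rot .rotSq .dbl
  | comm {k k' : K} (h : k ≠ k') (x y : Option Γ) :
      OpRel (.stk k x) (.stk k' y) (.stk k' y) (.stk k x)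

/-- The index set of the equations attached to a stack system. -/
inductive Idx (K Γ Q : Type) : Type
  | lower (x : Var K Γ Q)
  | upper (x : Var K Γ Q)
  | indep
  | oneSupA
  | oneSupB
  | oneInfA
  | eSupB
  | eSupC
  | eInfB
  | eInfC
  | opLe (f : Op K Γ)
  | opInf (f : Op K Γ)
  | halfLe
  | goalLe
  | stLe (q : Q)
  | rel (f g f' g' : Op K Γ)
  | halfInf
  | halfSup
  | halfSq
  | rule (o : Option (K × Option Γ)) (q : Q) (o' : Option (K × Option Γ)) (q' : Q)
  | bad (o : Option (K × Option Γ)) (q : Q)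

section Finiteness

variable (K Γ Q : Type) [Finite K] [Finite Γ] [Finite Q]

instance : Finite (Op K Γ) := by
  let f : Fin 6 ⊕ (K × Option Γ) → Op K Γ
    | .inl i => ![.one, .rot, .rotInv, .rotSq, .dbl, .dblInv] i
    | .inr (k, x) => .stk k x
  refine Finite.of_surjective f fun y => ?_
  cases y
  exacts [⟨.inl 0, rfl⟩, ⟨.inl 1, rfl⟩, ⟨.inl 2, rfl⟩, ⟨.inl 3, rfl⟩, ⟨.inl 4, rfl⟩,
    ⟨.inl 5, rfl⟩, ⟨.inr (_, _), rfl⟩]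

instance : Finite (Var K Γ Q) := by
  let f : Fin 7 ⊕ Op K Γ ⊕ Q → Var K Γ Q
    | .inl i => ![.bot, .a, .b, .c, .e, .half, .goal] i
    | .inr (.inl f) => .op f
    | .inr (.inr q) => .st q
  refine Finite.of_surjective f fun y => ?_
  cases y
  exacts [⟨.inl 0, rfl⟩, ⟨.inl 1, rfl⟩, ⟨.inl 2, rfl⟩, ⟨.inl 3, rfl⟩, ⟨.inl 4, rfl⟩,
    ⟨.inl 5, rfl⟩, ⟨.inl 6, rfl⟩, ⟨.inr (.inl _), rfl⟩, ⟨.inr (.inr _), rfl⟩]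

instance : Finite (Idx K Γ Q) := by
  let f : Fin 13 ⊕ (Fin 2 × Var K Γ Q) ⊕ (Fin 2 × Op K Γ) ⊕ Q ⊕
      (Op K Γ × Op K Γ × Op K Γ × Op K Γ) ⊕
      (Option (K × Option Γ) × Q × Option (K × Option Γ) × Q) ⊕
      (Option (K × Option Γ) × Q) → Idx K Γ Q
    | .inl i => ![.indep, .oneSupA, .oneSupB, .oneInfA, .eSupB, .eSupC, .eInfB, .halfLe, .goalLe,
        .halfInf, .halfSup, .halfSq, .eInfC] i
    | .inr (.inl (i, x)) => ![.lower x, .upper x] i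
    | .inr (.inr (.inl (i, f))) => ![.opLe f, .opInf f] i
    | .inr (.inr (.inr (.inl q))) => .stLe q
    | .inr (.inr (.inr (.inr (.inl (f, g, f', g'))))) => .rel f g f' g'
    | .inr (.inr (.inr (.inr (.inr (.inl (o, q, o', q')))))) => .rule o q o' q'
    | .inr (.inr (.inr (.inr (.inr (.inr (o, q)))))) => .bad o q
  refine Finite.of_surjective f fun y => ?_
  cases y with
  | lower x => exact ⟨.inr (.inl (0, x)), rfl⟩
  | upper x => exact ⟨.inr (.inl (1, x)), rfl⟩
  | indep => exact ⟨.inl 0, rfl⟩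
  | oneSupA => exact ⟨.inl 1, rfl⟩
  | oneSupB => exact ⟨.inl 2, rfl⟩
  | oneInfA => exact ⟨.inl 3, rfl⟩
  | eSupB => exact ⟨.inl 4, rfl⟩
  | eSupC => exact ⟨.inl 5, rfl⟩
  | eInfB => exact ⟨.inl 6, rfl⟩
  | halfLe => exact ⟨.inl 7, rfl⟩
  | goalLe => exact ⟨.inl 8, rfl⟩
  | halfInf => exact ⟨.inl 9, rfl⟩
  | halfSup => exact ⟨.inl 10, rfl⟩
  | halfSq => exact ⟨.inl 11, rfl⟩
  | eInfC => exact ⟨.inl 12, rfl⟩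
  | opLe f => exact ⟨.inr (.inr (.inl (0, f))), rfl⟩
  | opInf f => exact ⟨.inr (.inr (.inl (1, f))), rfl⟩
  | stLe q => exact ⟨.inr (.inr (.inr (.inl q))), rfl⟩
  | rel f g f' g' => exact ⟨.inr (.inr (.inr (.inr (.inl (f, g, f', g'))))), rfl⟩
  | rule o q o' q' => exact ⟨.inr (.inr (.inr (.inr (.inr (.inl (o, q, o', q')))))), rfl⟩
  | bad o q => exact ⟨.inr (.inr (.inr (.inr (.inr (.inr (o, q)))))), rfl⟩

end Finiteness

/-- A rewriting system on states with stacks. In a rule `rule o q o' q'`, what remains of a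
configuration in state `q` after performing the stack operation `o` is what remains of the
successor configuration in state `q'` after performing `o'`. -/
structure StackSystem (K Γ Q : Type) where
  /-- the rewriting rules -/
  rule : Option (K × Option Γ) → Q → Option (K × Option Γ) → Q → Prop
  /-- the forbidden configurations -/
  bad : Option (K × Option Γ) → Q → Prop

/-- The operator attached to an optional stack operation. -/
def opOf {K Γ : Type} : Option (K × Option Γ) → Op K Γ
  | none => .one
  | some (k, x) => .stk k x

section Equations

variable {K Γ Q : Type}

/-- The term for the image of `t` under the operator `f`. -/
def actTerm (f : Op K Γ) (t : Term (Var K Γ Q)) : Term (Var K Γ Q) :=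
  (((t ⊔ .var (.op f)) ⊓ .var .b) ⊔ .var (.op .one)) ⊓ .var .a

/-- The term for the composition `f * g`, as a relation from `a` to `c`. -/
def compTerm (f g : Op K Γ) : Term (Var K Γ Q) :=
  (.var (.op g) ⊔ (.var (.op .one) ⊔ (.var (.op f) ⊔ .var .e) ⊓ (.var .a ⊔ .var .c)) ⊓
    (.var .b ⊔ .var .c)) ⊓ (.var .a ⊔ .var .c)

open scoped Classical in
/-- The equations attached to a stack system; `s ≤ t` is expressed as `s ⊔ t = t`. -/
noncomputable def StackSystem.eqn (sys : StackSystem K Γ Q) :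
    Idx K Γ Q → Term (Var K Γ Q) × Term (Var K Γ Q)
  | .lower x => (.var .bot ⊔ .var x, .var x)
  | .upper x => (.var x ⊔ (.var .a ⊔ .var .b ⊔ .var .c), .var .a ⊔ .var .b ⊔ .var .c)
  | .indep => ((.var .a ⊔ .var .b) ⊓ .var .c, .var .bot)
  | .oneSupA => (.var (.op .one) ⊔ .var .a, .var .a ⊔ .var .b)
  | .oneSupB => (.var (.op .one) ⊔ .var .b, .var .a ⊔ .var .b)
  | .oneInfA => (.var (.op .one) ⊓ .var .a, .var .bot)
  | .eSupB => (.var .e ⊔ .var .b, .var .b ⊔ .var .c)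
  | .eSupC => (.var .e ⊔ .var .c, .var .b ⊔ .var .c)
  | .eInfB => (.var .e ⊓ .var .b, .var .bot)
  | .eInfC => (.var .e ⊓ .var .c, .var .bot)
  | .opLe f => (.var (.op f) ⊔ (.var .a ⊔ .var .b), .var .a ⊔ .var .b)
  | .opInf f => (.var (.op f) ⊓ .var .b, .var .bot)
  | .halfLe => (.var .half ⊔ .var .a, .var .a)
  | .goalLe => (.var .goal ⊔ .var .a, .var .a)
  | .stLe q => (.var (.st q) ⊔ .var .a, .var .a)
  | .rel f g f' g' =>
      if OpRel f g f' g' then (compTerm f g, compTerm f' g') else (.var .bot, .var .bot)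
  | .halfInf => (.var .half ⊓ actTerm .rot (.var .half), .var .bot)
  | .halfSup => (.var .half ⊔ actTerm .rot (.var .half) ⊔ .var .goal, .var .a)
  | .halfSq => (actTerm .rotSq (.var .half) ⊔ (.var .half ⊔ .var .goal), .var .half ⊔ .var .goal)
  | .rule o q o' q' =>
      if sys.rule o q o' q' then
        (actTerm (opOf o) (.var (.st q)) ⊔ actTerm (opOf o') (.var (.st q')),
          actTerm (opOf o') (.var (.st q')))
      else (.var .bot, .var .bot)
  | .bad o q =>
      if sys.bad o q then (actTerm (opOf o) (.var (.st q)), .var .bot) else (.var .bot, .var .bot)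

/-- The term for the image of `t` under the successive stack operations `os`. -/
def stackTerm (os : List (K × Option Γ)) (t : Term (Var K Γ Q)) : Term (Var K Γ Q) :=
  os.foldl (fun t o => actTerm (.stk o.1 o.2) t) t

end Equations

section Stacks

variable {K Γ Q S X : Type} [DecidableEq K]

/-- Apply the partial operation `pop x` to the component `k` of `p`. -/
def pull (pop : X → S → Option S) : Option (K × X) → (K → S) → Option (K → S)
  | none, p => some p
  | some (k, x), p => (pop x (p k)).map (Function.update p k)

/-- Successive stack operations. -/
def pulls (pop : X → S → Option S) (os : List (K × X)) (p : K → S) : Option (K → S) :=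
  os.foldlM (fun p o => pull pop (some o) p) p

/-- Remove the letter `x` from the top of a stack (`some x`), or close an empty stack (`none`). -/
def pop [DecidableEq Γ] : Option Γ → Option (List Γ) → Option (Option (List Γ))
  | some x, some (y :: l) => if x = y then some (some l) else none
  | none, some [] => some none
  | _, _ => none

/-- One rewriting step of a stack system. -/
def StackSystem.Step [DecidableEq Γ] (sys : StackSystem K Γ Q) (c c' : Q × (K → List Γ)) : Prop :=
  ∃ o o' p, sys.rule o c.1 o' c'.1 ∧ pull pop o (some ∘ c.2) = some p ∧
    pull pop o' (some ∘ c'.2) = some p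

end Stacks

section Tower

variable {K Γ M : Type*} [Monoid M]

/-- The product of the operators that successively remove a stack. -/
def tower (z : Option Γ → M) : Option (List Γ) → M
  | none => 1
  | some [] => z none
  | some (x :: l) => tower z (some l) * z (some x)

theorem Commute.tower_right {z : Option Γ → M} {m : M} (h : ∀ x, Commute m (z x))
    (s : Option (List Γ)) : Commute m (tower z s) := by
  induction s using tower.induct with
  | case1 => rw [tower]; exact Commute.one_right m
  | case2 => rw [tower]; exact h none
  | case3 x l ih => rw [tower]; exact ih.mul_right (h _)

theorem commute_tower {z z' : Option Γ → M} (h : ∀ x x', Commute (z x) (z' x'))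
    (s s' : Option (List Γ)) : Commute (tower z s) (tower z' s') :=
  Commute.tower_right (fun x' => (Commute.tower_right (fun x => (h x x').symm) s).symm) s'

theorem tower_of_pop {Γ : Type} [DecidableEq Γ] (z : Option Γ → M) {x : Option Γ}
    {s r : Option (List Γ)} (h : pop x s = some r) : tower z s = tower z r * z x := by
  rcases x with _ | x <;> rcases s with _ | _ | ⟨y, l⟩ <;> simp only [pop] at h
  all_goals try contradiction
  · cases h
    simp [tower]
  · split_ifs at h with hxy
    cases h
    rw [hxy, tower]

variable [Fintype K] {z : K → Option Γ → M}
  (hz : ∀ ⦃k k'⦄, k ≠ k' → ∀ x x', Commute (z k x) (z k' x'))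

theorem pairwise_commute_tower {z : K → Option Γ → M}
    (hz : ∀ ⦃k k'⦄, k ≠ k' → ∀ x x', Commute (z k x) (z k' x')) (p : K → Option (List Γ)) :
    ((Finset.univ : Finset K) : Set K).Pairwise
      (Function.onFun Commute fun k => tower (z k) (p k)) :=
  fun _ _ _ _ hkk => commute_tower (hz hkk) _ _

/-- The product of the operators that remove all stacks. -/
def towerProd (p : K → Option (List Γ)) : M :=
  Finset.univ.noncommProd (fun k => tower (z k) (p k)) (pairwise_commute_tower hz p)

theorem towerProd_closed : towerProd hz (fun _ => none) = 1 := by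
  rw [towerProd, Finset.noncommProd_eq_pow_card _ _ _ 1 (fun k _ => by rw [tower]), one_pow]

theorem towerProd_of_pull {K Γ : Type} [Fintype K] [DecidableEq K] [DecidableEq Γ]
    {z : K → Option Γ → M} (hz : ∀ ⦃k k'⦄, k ≠ k' → ∀ x x', Commute (z k x) (z k' x'))
    {k : K} {x : Option Γ} {p p' : K → Option (List Γ)}
    (h : pull pop (some (k, x)) p = some p') :
    towerProd hz p = towerProd hz p' * z k x := by
  obtain ⟨r, hr, rfl⟩ := Option.map_eq_some_iff.1 h
  rw [towerProd, towerProd, ← Finset.noncommProd_erase_mul _ (Finset.mem_univ k),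
    ← Finset.noncommProd_erase_mul _ (Finset.mem_univ k)
      (fun k' => tower (z k') (Function.update p k r k')),
    mul_assoc, Function.update_self, ← tower_of_pop _ hr]
  congr 1
  refine Finset.noncommProd_congr rfl (fun k' hk' => ?_) _
  rw [Function.update_of_ne (Finset.ne_of_mem_erase hk')]

end Tower

section Collapse

variable {K Γ Q : Type} {L : Type*} [Lattice L]

/-- The assignment `v` satisfies the equations attached to `sys`. -/
def StackSystem.Models (sys : StackSystem K Γ Q) (v : Var K Γ Q → L) : Prop :=
  ∀ i, (sys.eqn i).1.eval v = (sys.eqn i).2.eval v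

/-- The image of `u` under the operator `f`. -/
def act (v : Var K Γ Q → L) (f : Op K Γ) (u : L) : L :=
  (((u ⊔ v (.op f)) ⊓ v .b) ⊔ v (.op .one)) ⊓ v .a

@[simp]
theorem eval_actTerm (v : Var K Γ Q → L) (f : Op K Γ) (t : Term (Var K Γ Q)) :
    (actTerm f t).eval v = act v f (t.eval v) := rfl

namespace StackSystem.Models

variable {sys : StackSystem K Γ Q} {v : Var K Γ Q → L}

theorem bot_le (h : sys.Models v) (x : Var K Γ Q) : v .bot ≤ v x := by
  simpa [StackSystem.eqn] using h (.lower x)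

theorem le_top (h : sys.Models v) (x : Var K Γ Q) : v x ≤ v .a ⊔ v .b ⊔ v .c := by
  simpa only [StackSystem.eqn, Term.eval_sup, Term.eval_var, sup_eq_right] using h (.upper x)

theorem indep (h : sys.Models v) : (v .a ⊔ v .b) ⊓ v .c = v .bot := h .indep

theorem op_le (h : sys.Models v) (f : Op K Γ) : v (.op f) ≤ v .a ⊔ v .b := by
  simpa only [StackSystem.eqn, Term.eval_sup, Term.eval_var, sup_eq_right] using h (.opLe f)

theorem op_inf (h : sys.Models v) (f : Op K Γ) : v (.op f) ⊓ v .b = v .bot := h (.opInf f)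

theorem half_le (h : sys.Models v) : v .half ≤ v .a := sup_eq_right.1 (h .halfLe)

theorem st_le (h : sys.Models v) (q : Q) : v (.st q) ≤ v .a := sup_eq_right.1 (h (.stLe q))

theorem comp_eq (h : sys.Models v) {f g f' g' : Op K Γ} (hr : OpRel f g f' g') :
    (compTerm f g).eval v = (compTerm f' g').eval v := by
  simpa only [StackSystem.eqn, if_pos hr] using h (.rel f g f' g')

theorem rule_le (h : sys.Models v) {o q o' q'} (hr : sys.rule o q o' q') :
    act v (opOf o) (v (.st q)) ≤ act v (opOf o') (v (.st q')) := by
  simpa only [StackSystem.eqn, if_pos hr, Term.eval_sup, eval_actTerm, Term.eval_var,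
    sup_eq_right] using h (.rule o q o' q')

theorem bad_eq (h : sys.Models v) {o q} (hr : sys.bad o q) :
    act v (opOf o) (v (.st q)) = v .bot := by
  simpa only [StackSystem.eqn, if_pos hr, eval_actTerm, Term.eval_var] using h (.bad o q)

theorem bot_le_act (h : sys.Models v) (f : Op K Γ) (u : L) : v .bot ≤ act v f u :=
  le_inf ((h.bot_le _).trans le_sup_right) (h.bot_le _)

/-- The operator `f` as a monotone self-map of the interval below `a`. -/
def opHom (h : sys.Models v) (f : Op K Γ) : Set.Icc (v .bot) (v .a) →o Set.Icc (v .bot) (v .a) where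
  toFun u := ⟨act v f u, h.bot_le_act f u, inf_le_right⟩
  monotone' u u' huu := by
    have : (u : L) ≤ u' := huu
    change act v f u ≤ act v f u'
    unfold act
    gcongr

/-- The least element of the interval below `a`. -/
def zero (h : sys.Models v) : Set.Icc (v .bot) (v .a) := ⟨v .bot, le_rfl, h.bot_le _⟩

theorem opHom_zero (h : sys.Models v) (f : Op K Γ) : h.opHom f h.zero = h.zero := by
  apply Subtype.ext
  change (((v .bot ⊔ v (.op f)) ⊓ v .b) ⊔ v (.op .one)) ⊓ v .a = v .bot
  rw [sup_eq_right.2 (h.bot_le _), h.op_inf, sup_eq_right.2 (h.bot_le _)]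
  exact h .oneInfA

variable [IsModularLattice L]

theorem opHom_one (h : sys.Models v) : h.opHom .one = 1 := by
  ext u
  exact perspectivity_cancel (h .oneSupA) (h .oneSupB) (h .oneInfA) u.2.1 u.2.2

theorem act_act (h : sys.Models v) (f g : Op K Γ) {u : L} (hu : u ≤ v .a) :
    act v f (act v g u) =
      ((((((u ⊔ (compTerm f g).eval v) ⊓ v .c) ⊔ v .e) ⊓ v .b) ⊔ v (.op .one)) ⊓ v .a) := by
  have he : v .e ≤ v .b ⊔ v .c := (le_sup_left : v .e ≤ v .e ⊔ v .b).trans_eq (h .eSupB)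
  have hb : (v .a ⊔ v .b) ⊓ v .c ≤ v .b := h.indep.trans_le (h.bot_le _)
  have ha : (v .b ⊔ v .a) ⊓ v .c ≤ v .a := by
    rw [sup_comm, h.indep]
    exact h.bot_le _
  have h₁ : (u ⊔ (compTerm f g).eval v) ⊓ v .c =
      (((act v g u ⊔ v (.op f)) ⊓ v .b) ⊔ v .e) ⊓ v .c :=
    (perspectivity_comp hb hu (h.op_le g) inf_le_right).trans <|
      (perspectivity_comp ha inf_le_right ((h.op_le .one).trans_eq (sup_comm _ _))
        inf_le_right).trans <|
      perspectivity_comp hb inf_le_right (h.op_le f) he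
  have heb : v .e ⊔ v .b = v .b ⊔ v .c := h .eSupB
  have hec : v .e ⊔ v .c = v .b ⊔ v .c := h .eSupC
  have he₀ : v .e ⊓ v .b = v .bot := h .eInfB
  rw [h₁, perspectivity_cancel heb hec he₀
    (le_inf ((h.bot_le _).trans le_sup_right) (h.bot_le _)) inf_le_right]
  rfl

theorem opHom_mul (h : sys.Models v) {f g f' g' : Op K Γ} (hr : OpRel f g f' g') :
    h.opHom f * h.opHom g = h.opHom f' * h.opHom g' := by
  ext u
  change act v f (act v g u) = act v f' (act v g' u)
  rw [h.act_act f g u.2.2, h.act_act f' g' u.2.2, h.comp_eq hr]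

theorem commute_opHom (h : sys.Models v) ⦃k k' : K⦄ (hk : k ≠ k') (x y : Option Γ) :
    Commute (h.opHom (.stk k x)) (h.opHom (.stk k' y)) :=
  h.opHom_mul (.comm hk x y)

/-- The invertible map given by the rotation. -/
def rot (h : sys.Models v) : (Set.Icc (v .bot) (v .a) →o Set.Icc (v .bot) (v .a))ˣ where
  val := h.opHom .rot
  inv := h.opHom .rotInv
  val_inv := by rw [h.opHom_mul .rot_mul_rotInv, h.opHom_one, one_mul]
  inv_val := by rw [h.opHom_mul .rotInv_mul_rot, h.opHom_one, one_mul]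

/-- The invertible map given by the doubling. -/
def dbl (h : sys.Models v) : (Set.Icc (v .bot) (v .a) →o Set.Icc (v .bot) (v .a))ˣ where
  val := h.opHom .dbl
  inv := h.opHom .dblInv
  val_inv := by rw [h.opHom_mul .dbl_mul_dblInv, h.opHom_one, one_mul]
  inv_val := by rw [h.opHom_mul .dblInv_mul_dbl, h.opHom_one, one_mul]

theorem rot_sq (h : sys.Models v) : ((h.rot ^ 2 : (_ →o _)ˣ) : _ →o _) = h.opHom .rotSq := by
  rw [sq, Units.val_mul]
  exact (h.opHom_mul .rot_mul_rot).trans (by rw [h.opHom_one, mul_one])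

theorem dbl_mul_rot (h : sys.Models v) : h.dbl * h.rot = h.rot ^ 2 * h.dbl := by
  apply Units.ext
  rw [Units.val_mul, Units.val_mul, rot_sq]
  exact h.opHom_mul .dbl_mul_rot

theorem exists_rot_eq_pow (h : sys.Models v) [Finite L] : ∃ m : ℕ, h.rot = (h.rot ^ 2) ^ m := by
  have : Finite (Set.Icc (v .bot) (v .a) →o Set.Icc (v .bot) (v .a)) := DFunLike.finite _
  have hf : IsOfFinOrder h.rot := isOfFinOrder_of_finite _
  have ho : orderOf (h.rot ^ 2) = orderOf h.rot :=
    (orderOf_injective (MulAut.conj h.dbl).toMonoidHom (MulAut.conj h.dbl).injective h.rot).symm ▸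
      congrArg orderOf (by simp [h.dbl_mul_rot])
  have hc : (orderOf h.rot).Coprime 2 := by
    rw [orderOf_pow' _ two_ne_zero] at ho
    have := hf.orderOf_pos
    rcases (Nat.dvd_prime Nat.prime_two).1 ((orderOf h.rot).gcd_dvd_right 2) with hg | hg
    · exact hg
    · rw [hg] at ho
      omega
  obtain ⟨m, hm⟩ := exists_pow_eq_self_of_coprime hc.symm
  exact ⟨m, hm.symm⟩

/-- If the goal vanishes in a finite model, then the model is trivial. -/
theorem eq_bot_of_goal (h : sys.Models v) [Finite L] (hg : v .goal = v .bot) (x : Var K Γ Q) :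
    v x = v .bot := by
  let w : Set.Icc (v .bot) (v .a) := ⟨v .half, h.bot_le _, h.half_le⟩
  have hsq : h.opHom .rotSq w ≤ w := by
    have h' : act v .rotSq (v .half) ≤ v .half ⊔ v .goal := sup_eq_right.1 (h .halfSq)
    rw [hg, sup_eq_left.2 (h.bot_le _)] at h'
    exact h'
  have hpow : ∀ m : ℕ, (((h.rot ^ 2) ^ m : (_ →o _)ˣ) : _ →o _) w ≤ w := by
    intro m
    induction m with
    | zero => exact le_rfl
    | succ m ih =>
      rw [pow_succ, Units.val_mul, h.rot_sq]
      exact (OrderHom.monotone _ hsq).trans ih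
  obtain ⟨m, hm⟩ := h.exists_rot_eq_pow
  have hrot : h.opHom .rot w ≤ w := (congrArg (fun f : (_ →o _)ˣ => f.val w) hm).trans_le (hpow m)
  have hrot₀ : h.opHom .rot w = h.zero := by
    apply Subtype.ext
    have h' : v .half ⊓ act v .rot (v .half) = v .bot := h .halfInf
    rwa [inf_eq_right.2 (show act v .rot (v .half) ≤ v .half from hrot)] at h'
  have hhalf : v .half = v .bot := by
    have h' : w = h.zero :=
      calc w = (h.opHom .rotInv * h.opHom .rot) w := by
            rw [h.opHom_mul .rotInv_mul_rot, h.opHom_one, one_mul]; rfl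
        _ = h.zero := (congrArg _ hrot₀).trans (h.opHom_zero _)
    exact congrArg Subtype.val h'
  have ha : v .a = v .bot := by
    have h' : v .half ⊔ act v .rot (v .half) ⊔ v .goal = v .a := h .halfSup
    have h'' : act v .rot (v .half) = v .bot := congrArg Subtype.val hrot₀
    rw [hhalf] at h''
    rwa [hhalf, h'', hg, sup_idem, sup_idem, eq_comm] at h'
  have hb : v .b = v .bot := by
    have h' : v (.op .one) ⊔ v .a = v .a ⊔ v .b := h .oneSupA
    rw [ha, sup_eq_left.2 (h.bot_le _), sup_eq_right.2 (h.bot_le _)] at h'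
    simpa [h'] using h.op_inf .one
  have hc : v .c = v .bot := by
    have h' : v .e ⊔ v .b = v .b ⊔ v .c := h .eSupB
    have h'' : v .e ⊓ v .c = v .bot := h .eInfC
    rw [hb, sup_eq_left.2 (h.bot_le _), sup_eq_right.2 (h.bot_le _)] at h'
    simpa [h'] using h''
  refine le_antisymm ?_ (h.bot_le x)
  simpa [ha, hb, hc] using h.le_top x

variable [Fintype K]

theorem towerProd_zero (h : sys.Models v) (p : K → Option (List Γ)) :
    towerProd h.commute_opHom p h.zero = h.zero := by
  refine Finset.noncommProd_induction _ _ _ (fun f : _ →o _ => f h.zero = h.zero) ?_ rfl ?_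
  · intro f g hf hg
    exact (congrArg f hg).trans hf
  · intro k _
    induction p k using tower.induct with
    | case1 => rw [tower]; rfl
    | case2 => rw [tower]; exact h.opHom_zero _
    | case3 x l ih => rw [tower]; exact (congrArg _ (h.opHom_zero _)).trans ih

variable [DecidableEq K] [DecidableEq Γ]

/-- The element attached to a configuration. -/
def cfg (h : sys.Models v) (c : Q × (K → List Γ)) : Set.Icc (v .bot) (v .a) :=
  towerProd h.commute_opHom (some ∘ c.2) ⟨v (.st c.1), h.bot_le _, h.st_le _⟩

theorem towerProd_of_pull (h : sys.Models v) {o : Option (K × Option Γ)}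
    {p p' : K → Option (List Γ)}
    (hp : pull pop o p = some p') :
    towerProd h.commute_opHom p = towerProd h.commute_opHom p' * h.opHom (opOf o) := by
  rcases o with _ | ⟨k, x⟩
  · cases hp
    rw [opOf, h.opHom_one, mul_one]
  · exact ModularConsistency.towerProd_of_pull h.commute_opHom hp

theorem cfg_le_of_step (h : sys.Models v) {c c' : Q × (K → List Γ)} (hs : sys.Step c c') :
    h.cfg c ≤ h.cfg c' := by
  obtain ⟨o, o', p, hr, hp, hp'⟩ := hs
  rw [cfg, cfg, h.towerProd_of_pull hp, h.towerProd_of_pull hp']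
  exact (towerProd h.commute_opHom p).monotone (h.rule_le hr)

theorem cfg_eq_zero_of_bad (h : sys.Models v) {c : Q × (K → List Γ)} {o p} (hb : sys.bad o c.1)
    (hp : pull pop o (some ∘ c.2) = some p) : h.cfg c = h.zero := by
  rw [cfg, h.towerProd_of_pull hp, ← h.towerProd_zero p]
  have h' : h.opHom (opOf o) ⟨v (.st c.1), h.bot_le _, h.st_le _⟩ = h.zero :=
    Subtype.ext (h.bad_eq hb)
  exact congrArg (⇑(towerProd h.commute_opHom p)) h'

theorem eval_stackTerm (h : sys.Models v) (os : List (K × Option Γ)) {p p' : K → Option (List Γ)}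
    (hp : pulls pop os p = some p') (t : Term (Var K Γ Q)) (ht : v .bot ≤ t.eval v)
    (ht' : t.eval v ≤ v .a) :
    ∃ u : Set.Icc (v .bot) (v .a), (stackTerm os t).eval v = u ∧
      towerProd h.commute_opHom p ⟨t.eval v, ht, ht'⟩ = towerProd h.commute_opHom p' u := by
  induction os generalizing p t with
  | nil =>
    cases hp
    exact ⟨_, rfl, rfl⟩
  | cons o os ih =>
    simp only [pulls, List.foldlM_cons, Option.bind_eq_bind, Option.bind_eq_some_iff] at hp
    obtain ⟨p₁, hp₁, hp⟩ := hp
    obtain ⟨u, hu, hu'⟩ := ih hp (actTerm (.stk o.1 o.2) t) (h.bot_le_act _ _) inf_le_right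
    refine ⟨u, hu, ?_⟩
    rw [h.towerProd_of_pull hp₁]
    exact hu'

theorem eq_bot_of_reaches_bad (h : sys.Models v) [Finite L] {c c' : Q × (K → List Γ)}
    {os : List (K × Option Γ)}
    (hg : v .goal = (stackTerm os (.var (.st c.1))).eval v)
    (hos : pulls pop os (some ∘ c.2) = some fun _ => none)
    (hcc : Relation.ReflTransGen sys.Step c c') {o p} (hb : sys.bad o c'.1)
    (hp : pull pop o (some ∘ c'.2) = some p) (x : Var K Γ Q) : v x = v .bot := by
  refine h.eq_bot_of_goal ?_ x
  obtain ⟨u, hu, hu'⟩ := h.eval_stackTerm os hos (.var (.st c.1)) (h.bot_le _) (h.st_le _)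
  have hle : h.cfg c ≤ h.cfg c' := by
    clear hg hos hb hp hu hu'
    induction hcc with
    | refl => exact le_rfl
    | tail _ hs ih => exact ih.trans (h.cfg_le_of_step hs)
  have hz : h.cfg c = h.zero :=
    le_antisymm (hle.trans_eq (h.cfg_eq_zero_of_bad hb hp)) (h.cfg c).2.1
  rw [towerProd_closed] at hu'
  exact hg.trans (hu.trans (congrArg Subtype.val (hu'.symm.trans hz)))

end StackSystem.Models

end Collapse

section Coordinates

variable {R V : Type*} [Ring R] [AddCommGroup V] [Module R V]

/-- The first coordinate axis part given by `U`. -/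
def emb (U : Submodule R V) : Submodule R (V × V × V) := U.prod ⊥

/-- The negative of the graph of `T`, in the first two coordinates. -/
def graph (T : V →ₗ[R] V) : Submodule R (V × V × V) :=
  LinearMap.range (LinearMap.id.prod ((-T).prod 0))

/-- The negative of the graph of the identity, in the last two coordinates. -/
def diag (R V : Type*) [Ring R] [AddCommGroup V] [Module R V] : Submodule R (V × V × V) :=
  LinearMap.range ((0 : V →ₗ[R] V).prod ((LinearMap.id).prod (-LinearMap.id)))

/-- The second coordinate axis. -/
def axB (R V : Type*) [Ring R] [AddCommGroup V] [Module R V] : Submodule R (V × V × V) :=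
  (⊥ : Submodule R V).prod ((⊤ : Submodule R V).prod ⊥)

/-- The third coordinate axis. -/
def axC (R V : Type*) [Ring R] [AddCommGroup V] [Module R V] : Submodule R (V × V × V) :=
  (⊥ : Submodule R V).prod ((⊥ : Submodule R V).prod ⊤)

theorem mem_graph {T : V →ₗ[R] V} {x : V × V × V} :
    x ∈ graph T ↔ x.2.1 = -T x.1 ∧ x.2.2 = 0 := by
  constructor
  · rintro ⟨w, rfl⟩
    exact ⟨rfl, rfl⟩
  · rintro ⟨h₁, h₂⟩
    exact ⟨x.1, Prod.ext rfl (Prod.ext h₁.symm h₂.symm)⟩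

theorem mem_diag {x : V × V × V} : x ∈ diag R V ↔ x.1 = 0 ∧ x.2.2 = -x.2.1 := by
  constructor
  · rintro ⟨w, rfl⟩
    exact ⟨rfl, rfl⟩
  · rintro ⟨h₁, h₂⟩
    exact ⟨x.2.1, Prod.ext h₁.symm (Prod.ext rfl h₂.symm)⟩

theorem mem_emb {U : Submodule R V} {x : V × V × V} :
    x ∈ emb U ↔ x.1 ∈ U ∧ x.2.1 = 0 ∧ x.2.2 = 0 := by
  obtain ⟨x, y, z⟩ := x
  simp [emb, Submodule.mem_prod]

theorem mem_axB {x : V × V × V} : x ∈ axB R V ↔ x.1 = 0 ∧ x.2.2 = 0 := by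
  obtain ⟨x, y, z⟩ := x
  simp [axB, Submodule.mem_prod]

theorem mem_axC {x : V × V × V} : x ∈ axC R V ↔ x.1 = 0 ∧ x.2.1 = 0 := by
  obtain ⟨x, y, z⟩ := x
  simp [axC, Submodule.mem_prod]

theorem emb_sup (U W : Submodule R V) : emb U ⊔ emb W = emb (U ⊔ W) := by
  simp [emb]

theorem emb_inf (U W : Submodule R V) : emb U ⊓ emb W = emb (U ⊓ W) := by
  simp [emb]

theorem emb_bot : emb (⊥ : Submodule R V) = ⊥ := by
  simp [emb]

theorem emb_mono {U W : Submodule R V} (h : U ≤ W) : emb U ≤ emb W :=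
  Submodule.prod_mono h le_rfl

theorem mem_emb_top_sup_axB {x : V × V × V} :
    x ∈ emb (⊤ : Submodule R V) ⊔ axB R V ↔ x.2.2 = 0 := by
  obtain ⟨x, y, z⟩ := x
  simp [emb, axB, Submodule.mem_prod, ← Submodule.prod_bot]

theorem mem_emb_top_sup_axC {x : V × V × V} :
    x ∈ emb (⊤ : Submodule R V) ⊔ axC R V ↔ x.2.1 = 0 := by
  obtain ⟨x, y, z⟩ := x
  simp [emb, axC, Submodule.mem_prod, ← Submodule.prod_bot]

theorem mem_axB_sup_axC {x : V × V × V} : x ∈ axB R V ⊔ axC R V ↔ x.1 = 0 := by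
  obtain ⟨x, y, z⟩ := x
  simp [axB, axC, Submodule.mem_prod]

theorem emb_top_sup_axB_sup_axC : emb (⊤ : Submodule R V) ⊔ axB R V ⊔ axC R V = ⊤ := by
  simp [emb, axB, axC, ← Submodule.prod_bot, ← Submodule.prod_top]

theorem emb_top_sup_axB_inf_axC : (emb (⊤ : Submodule R V) ⊔ axB R V) ⊓ axC R V = ⊥ := by
  ext ⟨x, y, z⟩
  rw [Submodule.mem_inf, mem_emb_top_sup_axB, mem_axC]
  simp only [Submodule.mem_bot, Prod.mk_eq_zero]
  tauto

theorem graph_le (T : V →ₗ[R] V) : graph T ≤ emb ⊤ ⊔ axB R V := fun _ hx =>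
  mem_emb_top_sup_axB.2 (mem_graph.1 hx).2

theorem graph_inf_axB (T : V →ₗ[R] V) : graph T ⊓ axB R V = ⊥ := by
  ext ⟨x, y, z⟩
  simp only [Submodule.mem_inf, mem_graph, mem_axB, Submodule.mem_bot, Prod.mk_eq_zero]
  constructor
  · rintro ⟨⟨rfl, rfl⟩, rfl, -⟩
    simp
  · rintro ⟨rfl, rfl, rfl⟩
    simp

theorem graph_id_inf_emb_top : graph (LinearMap.id : V →ₗ[R] V) ⊓ emb ⊤ = ⊥ := by
  ext ⟨x, y, z⟩
  simp only [Submodule.mem_inf, mem_graph, mem_emb, Submodule.mem_bot, Prod.mk_eq_zero]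
  constructor
  · rintro ⟨⟨rfl, rfl⟩, -, h, -⟩
    simpa using h
  · rintro ⟨rfl, rfl, rfl⟩
    simp

theorem graph_id_sup_emb_top :
    graph (LinearMap.id : V →ₗ[R] V) ⊔ emb ⊤ = emb ⊤ ⊔ axB R V := by
  refine le_antisymm (sup_le (graph_le _) le_sup_left) fun ⟨x, y, z⟩ h => ?_
  obtain rfl : z = 0 := mem_emb_top_sup_axB.1 h
  exact Submodule.mem_sup.2 ⟨(-y, y, 0), mem_graph.2 ⟨by simp, rfl⟩, (x + y, 0, 0),
    mem_emb.2 ⟨trivial, rfl, rfl⟩, by simp⟩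

theorem graph_id_sup_axB :
    graph (LinearMap.id : V →ₗ[R] V) ⊔ axB R V = emb ⊤ ⊔ axB R V := by
  refine le_antisymm (sup_le (graph_le _) le_sup_right) fun ⟨x, y, z⟩ h => ?_
  obtain rfl : z = 0 := mem_emb_top_sup_axB.1 h
  exact Submodule.mem_sup.2 ⟨(x, -x, 0), mem_graph.2 ⟨rfl, rfl⟩, (0, x + y, 0),
    mem_axB.2 ⟨rfl, rfl⟩, by simp⟩

theorem diag_le : diag R V ≤ axB R V ⊔ axC R V := fun _ hx =>
  mem_axB_sup_axC.2 (mem_diag.1 hx).1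

theorem diag_sup_axB : diag R V ⊔ axB R V = axB R V ⊔ axC R V := by
  refine le_antisymm (sup_le diag_le le_sup_left) fun ⟨x, y, z⟩ h => ?_
  obtain rfl : x = 0 := mem_axB_sup_axC.1 h
  exact Submodule.mem_sup.2 ⟨(0, -z, z), mem_diag.2 ⟨rfl, by simp⟩, (0, z + y, 0),
    mem_axB.2 ⟨rfl, rfl⟩, by simp⟩

theorem diag_sup_axC : diag R V ⊔ axC R V = axB R V ⊔ axC R V := by
  refine le_antisymm (sup_le diag_le le_sup_right) fun ⟨x, y, z⟩ h => ?_
  obtain rfl : x = 0 := mem_axB_sup_axC.1 h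
  exact Submodule.mem_sup.2 ⟨(0, y, -y), mem_diag.2 ⟨rfl, rfl⟩, (0, 0, y + z),
    mem_axC.2 ⟨rfl, rfl⟩, by simp⟩

theorem diag_inf_axB : diag R V ⊓ axB R V = ⊥ := by
  ext ⟨x, y, z⟩
  simp only [Submodule.mem_inf, mem_diag, mem_axB, Submodule.mem_bot, Prod.mk_eq_zero]
  constructor
  · rintro ⟨⟨rfl, rfl⟩, -, h⟩
    simpa using h
  · rintro ⟨rfl, rfl, rfl⟩
    simp

theorem diag_inf_axC : diag R V ⊓ axC R V = ⊥ := by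
  ext ⟨x, y, z⟩
  simp only [Submodule.mem_inf, mem_diag, mem_axC, Submodule.mem_bot, Prod.mk_eq_zero]
  constructor
  · rintro ⟨⟨rfl, rfl⟩, -, rfl⟩
    simp
  · rintro ⟨rfl, rfl, rfl⟩
    simp

theorem act_graph (T : V →ₗ[R] V) (U : Submodule R V) :
    (((emb U ⊔ graph T) ⊓ axB R V) ⊔ graph LinearMap.id) ⊓ emb ⊤ = emb (U.map T) := by
  ext ⟨x, y, z⟩
  simp only [Submodule.mem_inf, Submodule.mem_sup, mem_emb, mem_graph, mem_axB, Prod.exists,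
    Prod.mk.injEq, Prod.mk_add_mk, Submodule.mem_map, Submodule.mem_top, true_and]
  constructor
  · rintro ⟨⟨_, y₁, _, ⟨⟨u, _, _, ⟨hu, rfl, rfl⟩, w, _, _, ⟨rfl, rfl⟩, h₁, h₂, rfl⟩, rfl, -⟩,
      s, _, _, ⟨rfl, rfl⟩, rfl, rfl, rfl⟩, h₃, -⟩
    obtain rfl : w = -u := by rw [eq_neg_iff_add_eq_zero, add_comm, h₁]
    refine ⟨⟨u, hu, ?_⟩, h₃, by simp⟩
    simp only [LinearMap.id_apply, ← h₂, map_neg] at h₃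
    simpa [add_neg_eq_zero] using h₃
  · rintro ⟨⟨u, hu, rfl⟩, rfl, rfl⟩
    exact ⟨⟨0, T u, 0, ⟨⟨u, 0, 0, ⟨hu, rfl, rfl⟩, -u, T u, 0, ⟨by simp, rfl⟩, by simp⟩, rfl, rfl⟩,
      T u, -T u, 0, ⟨rfl, rfl⟩, by simp⟩, rfl, rfl⟩

theorem comp_graph (T T' : V →ₗ[R] V) {x : V × V × V} :
    x ∈ (graph T' ⊔ (graph LinearMap.id ⊔ (graph T ⊔ diag R V) ⊓ (emb ⊤ ⊔ axC R V)) ⊓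
      (axB R V ⊔ axC R V)) ⊓ (emb ⊤ ⊔ axC R V) ↔ x.2.1 = 0 ∧ x.2.2 = -T (T' x.1) := by
  have h₁ : ∀ x, x ∈ (graph T ⊔ diag R V) ⊓ (emb ⊤ ⊔ axC R V) ↔ x.2.1 = 0 ∧ x.2.2 = -T x.1 := by
    rintro ⟨x, y, z⟩
    rw [Submodule.mem_inf, mem_emb_top_sup_axC]
    simp only [Submodule.mem_sup, mem_graph, mem_diag, Prod.exists, Prod.mk.injEq, Prod.mk_add_mk]
    constructor
    · rintro ⟨⟨w, _, _, ⟨rfl, rfl⟩, _, s, _, ⟨rfl, rfl⟩, rfl, rfl, rfl⟩, h⟩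
      obtain rfl : s = T w := by rw [← sub_eq_zero, sub_eq_neg_add, h]
      simp
    · rintro ⟨rfl, rfl⟩
      exact ⟨⟨x, -T x, 0, ⟨rfl, rfl⟩, 0, T x, -T x, ⟨rfl, rfl⟩, by simp⟩, rfl⟩
  have h₂ : ∀ x, x ∈ (graph LinearMap.id ⊔ (graph T ⊔ diag R V) ⊓ (emb ⊤ ⊔ axC R V)) ⊓
      (axB R V ⊔ axC R V) ↔ x.1 = 0 ∧ x.2.2 = -T x.2.1 := by
    rintro ⟨x, y, z⟩
    rw [Submodule.mem_inf, mem_axB_sup_axC]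
    simp only [Submodule.mem_sup, h₁, mem_graph, Prod.exists, Prod.mk.injEq, Prod.mk_add_mk]
    constructor
    · rintro ⟨⟨w, _, _, ⟨rfl, rfl⟩, s, _, _, ⟨rfl, rfl⟩, rfl, rfl, rfl⟩, h⟩
      obtain rfl : s = -w := by rw [eq_neg_iff_add_eq_zero, add_comm, h]
      simp
    · rintro ⟨rfl, rfl⟩
      exact ⟨⟨-y, y, 0, ⟨by simp, rfl⟩, y, 0, -T y, ⟨rfl, rfl⟩, by simp⟩, rfl⟩
  obtain ⟨x, y, z⟩ := x
  rw [Submodule.mem_inf, mem_emb_top_sup_axC]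
  simp only [Submodule.mem_sup, h₂, mem_graph, Prod.exists, Prod.mk.injEq, Prod.mk_add_mk]
  constructor
  · rintro ⟨⟨w, _, _, ⟨rfl, rfl⟩, _, s, _, ⟨rfl, rfl⟩, rfl, rfl, rfl⟩, h⟩
    obtain rfl : s = T' w := by rw [← sub_eq_zero, sub_eq_neg_add, h]
    simp
  · rintro ⟨rfl, rfl⟩
    exact ⟨⟨x, -T' x, 0, ⟨rfl, rfl⟩, 0, T' x, -T (T' x), ⟨rfl, rfl⟩, by simp⟩, rfl⟩

end Coordinates

section Partial

variable {P : Type}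

/-- The linear extension of a partial function. -/
noncomputable def lin (t : P → Option P) : (P →₀ ZMod 2) →ₗ[ZMod 2] (P →₀ ZMod 2) :=
  Finsupp.linearCombination (ZMod 2) fun p => (t p).elim 0 fun r => Finsupp.single r 1

theorem lin_single (t : P → Option P) (p : P) :
    lin t (Finsupp.single p 1) = (t p).elim 0 fun r => Finsupp.single r 1 := by
  simp [lin]

theorem lin_some : lin (some : P → Option P) = LinearMap.id := by
  ext p : 1
  ext
  simp [lin_single]

theorem lin_apply_lin (t s : P → Option P) (w : P →₀ ZMod 2) :
    lin t (lin s w) = lin (fun p => (s p).bind t) w := by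
  have : lin t ∘ₗ lin s = lin (fun p => (s p).bind t) := by
    apply Finsupp.lhom_ext'
    intro p
    ext : 1
    simp only [LinearMap.comp_apply, Finsupp.lsingle_apply, lin_single]
    cases s p <;> simp [lin_single]
  exact LinearMap.congr_fun this w

/-- The image of a set under a partial function. -/
def img (t : P → Option P) (E : Set P) : Set P := {r | ∃ p ∈ E, t p = some r}

/-- The submodule of the vectors supported on `E`, on the first coordinate axis. -/
noncomputable def axisSupp (E : Set P) :
    Submodule (ZMod 2) ((P →₀ ZMod 2) × (P →₀ ZMod 2) × (P →₀ ZMod 2)) :=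
  emb (Finsupp.supported (ZMod 2) (ZMod 2) E)

theorem map_lin_supported (t : P → Option P) (E : Set P) :
    (Finsupp.supported (ZMod 2) (ZMod 2) E).map (lin t) =
      Finsupp.supported (ZMod 2) (ZMod 2) (img t E) := by
  rw [Finsupp.supported_eq_span_single, Finsupp.supported_eq_span_single, Submodule.map_span]
  apply le_antisymm <;> rw [Submodule.span_le]
  · rintro _ ⟨_, ⟨p, hp, rfl⟩, rfl⟩
    rw [lin_single]
    cases h : t p with
    | none => exact Submodule.zero_mem _
    | some r => exact Submodule.subset_span ⟨r, ⟨p, hp, h⟩, rfl⟩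
  · rintro _ ⟨r, ⟨p, hp, h⟩, rfl⟩
    exact Submodule.subset_span ⟨_, ⟨p, hp, rfl⟩, by rw [lin_single, h]; rfl⟩

theorem axisSupp_mono {E F : Set P} (h : E ⊆ F) : axisSupp E ≤ axisSupp F :=
  emb_mono (Finsupp.supported_mono h)

theorem axisSupp_union (E F : Set P) : axisSupp E ⊔ axisSupp F = axisSupp (E ∪ F) := by
  rw [axisSupp, axisSupp, emb_sup, ← Finsupp.supported_union, axisSupp]

theorem axisSupp_inf_of_disjoint {E F : Set P} (h : Disjoint E F) :
    axisSupp E ⊓ axisSupp F = ⊥ := by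
  rw [axisSupp, axisSupp, emb_inf, (Finsupp.disjoint_supported_supported h).eq_bot, emb_bot]

theorem axisSupp_univ : axisSupp (Set.univ : Set P) = emb ⊤ := by
  rw [axisSupp, Finsupp.supported_univ]

theorem axisSupp_empty : axisSupp (∅ : Set P) = ⊥ := by
  rw [axisSupp, Finsupp.supported_empty, emb_bot]

end Partial

section Model

variable {K Γ Q P : Type} {m : ℕ}

/-- The partial functions interpreting the operators. -/
def opFun (σ : P ≃ ZMod (2 * m + 1)) (stk : K → Option Γ → P → Option P) :
    Op K Γ → P → Option P
  | .one, p => some p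
  | .rot, p => some (σ.symm (σ p + 1))
  | .rotInv, p => some (σ.symm (σ p - 1))
  | .rotSq, p => some (σ.symm (σ p + 2))
  | .dbl, p => some (σ.symm (2 * σ p))
  | .dblInv, p => some (σ.symm ((m + 1) * σ p))
  | .stk k x, p => stk k x p

/-- The points with an even coordinate different from the last one. -/
def evenSet (σ : P ≃ ZMod (2 * m + 1)) : Set P := {p | ∃ i : ℕ, i < m ∧ σ p = 2 * i}

/-- The subspace interpretation of the variables. -/
noncomputable def modelVal (σ : P ≃ ZMod (2 * m + 1)) (stk : K → Option Γ → P → Option P)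
    (star : P) (E : Q → Set P) : Var K Γ Q →
    Submodule (ZMod 2) ((P →₀ ZMod 2) × (P →₀ ZMod 2) × (P →₀ ZMod 2))
  | .bot => ⊥
  | .a => emb ⊤
  | .b => axB _ _
  | .c => axC _ _
  | .e => diag _ _
  | .half => axisSupp (evenSet σ)
  | .goal => axisSupp {star}
  | .op f => graph (lin (opFun σ stk f))
  | .st q => axisSupp (E q)

variable {σ : P ≃ ZMod (2 * m + 1)} {stk : K → Option Γ → P → Option P}
  {star : P} {E : Q → Set P}

theorem act_modelVal (f : Op K Γ) (F : Set P) :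
    act (modelVal σ stk star E) f (axisSupp F) = axisSupp (img (opFun σ stk f) F) := by
  have h := act_graph (lin (opFun σ stk f)) (Finsupp.supported (ZMod 2) (ZMod 2) F)
  rw [map_lin_supported, ← lin_some] at h
  exact h

theorem natCast_inj_of_lt {a b : ℕ} (ha : a < 2 * m + 1) (hb : b < 2 * m + 1)
    (h : (a : ZMod (2 * m + 1)) = b) : a = b := by
  rwa [ZMod.natCast_eq_natCast_iff', Nat.mod_eq_of_lt ha, Nat.mod_eq_of_lt hb] at h

theorem mem_img_rot {p : P} :
    p ∈ img (opFun σ stk .rot) (evenSet σ) ↔ ∃ i : ℕ, i < m ∧ σ p = 2 * i + 1 := by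
  constructor
  · rintro ⟨p', ⟨i, hi, hp⟩, h⟩
    obtain rfl := Option.some.inj h
    exact ⟨i, hi, by simp [hp]⟩
  · rintro ⟨i, hi, hp⟩
    exact ⟨σ.symm (2 * i), ⟨i, hi, by simp⟩, by simp [opFun, ← hp]⟩

theorem disjoint_img_rot : Disjoint (evenSet σ) (img (opFun σ stk .rot) (evenSet σ)) := by
  rw [Set.disjoint_left]
  rintro p ⟨i, hi, hp⟩ hp'
  obtain ⟨j, hj, hp'⟩ := mem_img_rot.1 hp'
  have := natCast_inj_of_lt (m := m) (a := 2 * i) (b := 2 * j + 1) (by omega) (by omega)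
    (by push_cast; rw [← hp, hp'])
  omega

theorem evenSet_union_img_rot (hs : σ star = 2 * m) :
    evenSet σ ∪ img (opFun σ stk .rot) (evenSet σ) ∪ {star} = Set.univ := by
  refine Set.eq_univ_of_forall fun p => ?_
  have hp : ((σ p).val : ZMod (2 * m + 1)) = σ p := ZMod.natCast_zmod_val _
  have hlt := ZMod.val_lt (σ p)
  rcases Nat.even_or_odd' (σ p).val with ⟨i, hi | hi⟩ <;> rw [hi] at hp hlt
  · rcases Nat.lt_or_ge i m with him | him
    · exact .inl (.inl ⟨i, him, by rw [← hp]; push_cast; rfl⟩)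
    · obtain rfl : i = m := by omega
      refine .inr (σ.injective ?_)
      rw [← hp, hs]
      push_cast
      rfl
  · exact .inl (.inr (mem_img_rot.2 ⟨i, by omega, by rw [← hp]; push_cast; rfl⟩))

theorem img_rotSq_subset (hs : σ star = 2 * m) :
    img (opFun σ stk .rotSq) (evenSet σ) ⊆ evenSet σ ∪ {star} := by
  rintro _ ⟨p, ⟨i, hi, hp⟩, h⟩
  obtain rfl := Option.some.inj h
  rcases Nat.lt_or_ge (i + 1) m with him | him
  · exact .inl ⟨i + 1, him, by simp [hp]; ring⟩
  · obtain rfl : m = i + 1 := by omega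
    refine .inr (σ.injective ?_)
    rw [Equiv.apply_symm_apply, hp, hs]
    push_cast
    ring

theorem opFun_bind {f g f' g' : Op K Γ}
    (hstk : ∀ k k', k ≠ k' → ∀ x x' p, (stk k' x' p).bind (stk k x) = (stk k x p).bind (stk k' x'))
    (hr : OpRel f g f' g') (p : P) :
    (opFun σ stk g p).bind (opFun σ stk f) = (opFun σ stk g' p).bind (opFun σ stk f') := by
  have h : (2 : ZMod (2 * m + 1)) * (m + 1) = 1 := by
    have := ZMod.natCast_self (2 * m + 1)
    push_cast at this
    linear_combination this
  cases hr with
  | rot_mul_rotInv => simp [opFun]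
  | rotInv_mul_rot => simp [opFun]
  | dbl_mul_dblInv => simp [opFun, ← mul_assoc, h]
  | dblInv_mul_dbl => simp [opFun, ← mul_assoc, mul_comm _ (2 : ZMod (2 * m + 1)), h]
  | rot_mul_rot => simp [opFun, add_assoc, one_add_one_eq_two]
  | dbl_mul_rot => simp [opFun, mul_add]
  | comm hk x x' => exact hstk _ _ hk x x' p

theorem models_modelVal (sys : StackSystem K Γ Q)
    (hstk : ∀ k k', k ≠ k' → ∀ x x' p, (stk k' x' p).bind (stk k x) = (stk k x p).bind (stk k' x'))
    (hs : σ star = 2 * m)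
    (hrule : ∀ o q o' q', sys.rule o q o' q' →
      img (opFun σ stk (opOf o)) (E q) ⊆ img (opFun σ stk (opOf o')) (E q'))
    (hbad : ∀ o q, sys.bad o q → img (opFun σ stk (opOf o)) (E q) = ∅) :
    sys.Models (modelVal σ stk star E) := by
  have hE : ∀ F : Set P, axisSupp F ≤ emb ⊤ := fun F => emb_mono le_top
  have hone : graph (lin (opFun σ stk .one)) = graph LinearMap.id := congrArg graph lin_some
  rintro (x | x | _ | _ | _ | _ | _ | _ | _ | _ | f | f | _ | _ | q | ⟨f, g, f', g'⟩ | _ | _ | _ |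
    ⟨o, q, o', q'⟩ | ⟨o, q⟩)
  · exact sup_eq_right.2 bot_le
  · exact sup_eq_right.2 (le_top.trans_eq emb_top_sup_axB_sup_axC.symm)
  · exact emb_top_sup_axB_inf_axC
  · exact (congrArg (· ⊔ emb ⊤) hone).trans graph_id_sup_emb_top
  · exact (congrArg (· ⊔ axB _ _) hone).trans graph_id_sup_axB
  · exact (congrArg (· ⊓ emb ⊤) hone).trans graph_id_inf_emb_top
  · exact diag_sup_axB
  · exact diag_sup_axC
  · exact diag_inf_axB
  · exact diag_inf_axC
  · exact sup_eq_right.2 (graph_le _)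
  · exact graph_inf_axB _
  · exact sup_eq_right.2 (hE _)
  · exact sup_eq_right.2 (hE _)
  · exact sup_eq_right.2 (hE _)
  · simp only [StackSystem.eqn]
    split_ifs with hr
    · have hc : ∀ f g : Op K Γ, ∀ w,
          w ∈ (compTerm (Q := Q) f g).eval (modelVal σ stk star E) ↔
            w.2.1 = 0 ∧ w.2.2 = -lin (fun p => (opFun σ stk g p).bind (opFun σ stk f)) w.1 := by
        intro f g w
        rw [← lin_apply_lin, ← comp_graph, ← hone]
        rfl
      ext w
      simp only [hc, opFun_bind hstk hr]
    · rfl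
  · change axisSupp _ ⊓ act (modelVal σ stk star E) .rot (axisSupp _) = ⊥
    rw [act_modelVal, axisSupp_inf_of_disjoint disjoint_img_rot]
  · change axisSupp _ ⊔ act (modelVal σ stk star E) .rot (axisSupp _) ⊔ axisSupp _ = emb ⊤
    rw [act_modelVal, axisSupp_union, axisSupp_union, evenSet_union_img_rot hs, axisSupp_univ]
  · refine sup_eq_right.2 ?_
    change act (modelVal σ stk star E) .rotSq (axisSupp _) ≤ axisSupp _ ⊔ axisSupp _
    rw [act_modelVal, axisSupp_union]
    exact axisSupp_mono (img_rotSq_subset hs)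
  · simp only [StackSystem.eqn]
    split_ifs with hr
    · refine sup_eq_right.2 ?_
      change act (modelVal σ stk star E) _ (axisSupp _) ≤ act (modelVal σ stk star E) _ (axisSupp _)
      rw [act_modelVal, act_modelVal]
      exact axisSupp_mono (hrule _ _ _ _ hr)
    · rfl
  · simp only [StackSystem.eqn]
    split_ifs with hr
    · change act (modelVal σ stk star E) _ (axisSupp _) = ⊥
      rw [act_modelVal, hbad _ _ hr, axisSupp_empty]
    · rfl

theorem eval_stackTerm_modelVal (os : List (K × Option Γ)) (t : Term (Var K Γ Q)) (F : Set P)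
    (ht : t.eval (modelVal σ stk star E) = axisSupp F) :
    (stackTerm os t).eval (modelVal σ stk star E) =
      axisSupp (img (fun p => os.foldlM (fun p o => stk o.1 o.2 p) p) F) := by
  induction os generalizing t F with
  | nil =>
    refine ht.trans (congrArg axisSupp (Set.ext fun p => ?_))
    simp [img]
  | cons o os ih =>
    refine (ih (actTerm (.stk o.1 o.2) t) (img (stk o.1 o.2) F) ?_).trans
      (congrArg axisSupp (Set.ext fun p => ?_))
    · rw [eval_actTerm, ht, act_modelVal]
      rfl
    · simp only [img, Set.mem_ofPred_eq, List.foldlM_cons, Option.bind_eq_bind,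
        Option.bind_eq_some_iff]
      grind

end Model

section StackModel

variable {K Γ Q S : Type} [DecidableEq K]

theorem pull_bind_pull {X : Type} (pop : X → S → Option S) {k k' : K} (hk : k ≠ k') (x x' : X)
    (p : K → S) : (pull pop (some (k', x')) p).bind (pull pop (some (k, x))) =
      (pull pop (some (k, x)) p).bind (pull pop (some (k', x'))) := by
  simp only [pull]
  cases h : pop x (p k) <;> cases h' : pop x' (p k') <;>
    simp [pull, h, h', Function.update_of_ne hk, Function.update_of_ne hk.symm,
      Function.update_comm hk]

/-- A finite set of configurations closed under the rules, without forbidden configurations,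
yields a non-trivial finite model. -/
theorem exists_model [Finite K] [Finite S] (pop : Option Γ → S → Option S)
    (sys : StackSystem K Γ Q) (E : Q → Set (K → S)) (q₀ : Q) (os : List (K × Option Γ))
    (star : K → S)
    (hrule : ∀ o q o' q', sys.rule o q o' q' → ∀ p ∈ E q, ∀ r, pull pop o p = some r →
      ∃ p' ∈ E q', pull pop o' p' = some r)
    (hbad : ∀ o q, sys.bad o q → ∀ p ∈ E q, pull pop o p = none)
    (hos : ∀ r, (∃ p ∈ E q₀, pulls pop os p = some r) ↔ r = star) :
    ∃ (L : Type) (_ : Lattice L) (_ : IsModularLattice L) (_ : Finite L) (v : Var K Γ Q → L),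
      sys.Models v ∧ v .goal = (stackTerm os (.var (.st q₀))).eval v ∧ v .goal ≠ v .bot := by
  let P := (K → S) ⊕ Option (K → S)
  let stk : K → Option Γ → P → Option P := fun k x p =>
    Sum.elim (fun p => (pull pop (some (k, x)) p).map Sum.inl) (fun _ => none) p
  let m := Nat.card (K → S)
  have hcard : Nat.card P = 2 * m + 1 := by
    rw [Nat.card_sum, Finite.card_option]
    omega
  have σ₀ : P ≃ ZMod (2 * m + 1) := (Finite.equivFinOfCardEq hcard).trans (ZMod.finEquiv _).toEquiv
  let σ : P ≃ ZMod (2 * m + 1) := σ₀.trans (Equiv.addRight (2 * m - σ₀ (.inl star)))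
  have hs : σ (.inl star) = 2 * m := by simp [σ]
  have : Finite (P →₀ ZMod 2) := DFunLike.finite _
  have hop : ∀ o p, opFun σ stk (opOf o) (.inl p) = (pull pop o p).map Sum.inl := by
    rintro (_ | ⟨k, x⟩) p <;> rfl
  refine ⟨_, inferInstance, inferInstance, inferInstance,
    modelVal σ stk (.inl star) fun q => Sum.inl '' E q, models_modelVal sys ?_ hs ?_ ?_, ?_, ?_⟩
  · rintro k k' hk x x' (p | p)
    · have h := congrArg (Option.map (Sum.inl : _ → P)) (pull_bind_pull pop hk x x' p)
      simp only [stk, Sum.elim_inl]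
      rw [Option.bind_map, Option.bind_map]
      rw [Option.map_bind, Option.map_bind] at h
      exact h
    · rfl
  · rintro o q o' q' hr _ ⟨_, ⟨p, hp, rfl⟩, h⟩
    rw [hop, Option.map_eq_some_iff] at h
    obtain ⟨r, hr', rfl⟩ := h
    obtain ⟨p', hp', h'⟩ := hrule o q o' q' hr p hp r hr'
    exact ⟨.inl p', ⟨p', hp', rfl⟩, by rw [hop, h']; rfl⟩
  · rintro o q hb
    rw [Set.eq_empty_iff_forall_notMem]
    rintro r ⟨_, ⟨p, hp, rfl⟩, h⟩
    rw [hop, hbad o q hb p hp] at h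
    cases h
  · rw [eval_stackTerm_modelVal os _ (Sum.inl '' E q₀) rfl]
    have hfold : ∀ (os : List (K × Option Γ)) (p : K → S),
        os.foldlM (fun p o => stk o.1 o.2 p) (.inl p) = (pulls pop os p).map (Sum.inl : _ → P) := by
      intro os
      induction os with
      | nil => intro p; rfl
      | cons o os ih =>
        intro p
        simp only [pulls, List.foldlM_cons, Option.bind_eq_bind]
        simp only [stk, Sum.elim_inl]
        cases h : pull pop (some o) p with
        | none => rfl
        | some r => exact ih r
    refine congrArg axisSupp (Set.ext fun p => ?_)
    simp only [img, Set.mem_image, Set.mem_singleton_iff]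
    constructor
    · rintro rfl
      obtain ⟨p, hp, h⟩ := (hos star).2 rfl
      exact ⟨_, ⟨p, hp, rfl⟩, by rw [hfold, h]; rfl⟩
    · rintro ⟨_, ⟨p', hp', rfl⟩, h⟩
      rw [hfold, Option.map_eq_some_iff] at h
      obtain ⟨r, hr, rfl⟩ := h
      rw [(hos r).1 ⟨p', hp', hr⟩]
  · intro h
    have : ((Finsupp.single (.inl star) 1, 0, 0) : (P →₀ ZMod 2) × (P →₀ ZMod 2) × (P →₀ ZMod 2)) ∈
        axisSupp {(.inl star : P)} :=
      mem_emb.2 ⟨Finsupp.single_mem_supported _ _ rfl, rfl, rfl⟩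
    rw [show axisSupp {(.inl star : P)} = ⊥ from h, Submodule.mem_bot] at this
    simpa using congrArg Prod.fst this

end StackModel

section Bounded

variable {K Γ Q : Type}

/-- The inclusion of the bounded stacks into all stacks. -/
def unbdd (N : ℕ) : Option {l : List Γ // l.length ≤ N} → Option (List Γ) :=
  Option.map Subtype.val

theorem unbdd_injective (N : ℕ) : Function.Injective (unbdd (Γ := Γ) N) :=
  Option.map_injective Subtype.val_injective

variable [DecidableEq K] [DecidableEq Γ]

/-- The restriction of `pop` to stacks of bounded height. -/
def popBdd (N : ℕ) : Option Γ → Option {l : List Γ // l.length ≤ N} →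
    Option (Option {l : List Γ // l.length ≤ N})
  | some x, some ⟨y :: l, h⟩ =>
      if x = y then some (some ⟨l, (Nat.le_succ _).trans h⟩) else none
  | none, some ⟨[], _⟩ => some none
  | _, _ => none

theorem pop_unbdd (N : ℕ) (x : Option Γ) (s : Option {l : List Γ // l.length ≤ N}) :
    pop x (unbdd N s) = (popBdd N x s).map (unbdd N) := by
  rcases x with _ | x <;> rcases s with _ | ⟨_ | ⟨y, l⟩, h⟩ <;> simp [pop, popBdd, unbdd]

theorem pull_unbdd (N : ℕ) (o : Option (K × Option Γ))
    (p : K → Option {l : List Γ // l.length ≤ N}) :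
    pull pop o (unbdd N ∘ p) = (pull (popBdd N) o p).map (unbdd N ∘ ·) := by
  rcases o with _ | ⟨k, x⟩
  · rfl
  · simp only [pull, Function.comp_apply, pop_unbdd, Option.map_map]
    congr 1
    funext s
    exact (Function.comp_update (unbdd N) p k s).symm

theorem pulls_unbdd (N : ℕ) (os : List (K × Option Γ))
    (p : K → Option {l : List Γ // l.length ≤ N}) :
    pulls pop os (unbdd N ∘ p) = (pulls (popBdd N) os p).map (unbdd N ∘ ·) := by
  induction os generalizing p with
  | nil => rfl
  | cons o os ih =>
    simp only [pulls, List.foldlM_cons, Option.bind_eq_bind, pull_unbdd]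
    cases h : pull (popBdd N) (some o) p with
    | none => rfl
    | some r => exact ih r

theorem isSome_of_pop {x : Option Γ} {s r : Option (List Γ)} (h : pop x s = some r) :
    r.isSome = x.isSome := by
  rcases x with _ | x <;> rcases s with _ | _ | ⟨y, l⟩ <;> simp only [pop] at h
  all_goals try contradiction
  · cases h
    rfl
  · split_ifs at h
    cases h
    rfl

/-- Which stacks are closed by a sequence of operations depends only on the operations. -/
theorem isSome_of_pulls {os : List (K × Option Γ)} {p p' r r' : K → Option (List Γ)}
    (hp : ∀ k, (p k).isSome = (p' k).isSome) (h : pulls pop os p = some r)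
    (h' : pulls pop os p' = some r') (k : K) : (r k).isSome = (r' k).isSome := by
  induction os generalizing p p' with
  | nil =>
    cases h
    cases h'
    exact hp k
  | cons o os ih =>
    simp only [pulls, List.foldlM_cons, Option.bind_eq_bind, Option.bind_eq_some_iff] at h h'
    obtain ⟨s, hs, h⟩ := h
    obtain ⟨s', hs', h'⟩ := h'
    refine ih (fun k => ?_) h h'
    obtain ⟨t, ht, rfl⟩ := Option.map_eq_some_iff.1 hs
    obtain ⟨t', ht', rfl⟩ := Option.map_eq_some_iff.1 hs'
    rcases eq_or_ne k o.1 with rfl | hk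
    · rw [Function.update_self, Function.update_self, isSome_of_pop ht, isSome_of_pop ht']
    · rw [Function.update_of_ne hk, Function.update_of_ne hk, hp]

theorem exists_model_of_finite [Finite K] [Finite Γ] (sys : StackSystem K Γ Q)
    {F : Set (Q × (K → List Γ))} (hF : F.Finite) {c₀ : Q × (K → List Γ)} (hc₀ : c₀ ∈ F)
    {os : List (K × Option Γ)} (hos : pulls pop os (some ∘ c₀.2) = some fun _ => none)
    (hrule : ∀ o q o' q', sys.rule o q o' q' → ∀ S, (q, S) ∈ F → ∀ p,
      pull pop o (some ∘ S) = some p → ∃ S', (q', S') ∈ F ∧ pull pop o' (some ∘ S') = some p)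
    (hbad : ∀ o q, sys.bad o q → ∀ S, (q, S) ∈ F → pull pop o (some ∘ S) = none) :
    ∃ (L : Type) (_ : Lattice L) (_ : IsModularLattice L) (_ : Finite L) (v : Var K Γ Q → L),
      sys.Models v ∧ v .goal = (stackTerm os (.var (.st c₀.1))).eval v ∧ v .goal ≠ v .bot := by
  obtain ⟨N, hN⟩ : ∃ N, ∀ c ∈ F, ∀ k, (c.2 k).length ≤ N := by
    obtain ⟨N, hN⟩ := ((hF.prod (Set.finite_univ (α := K))).image
      fun ck => (ck.1.2 ck.2).length).bddAbove
    exact ⟨N, fun c hc k => hN ⟨(c, k), ⟨hc, trivial⟩, rfl⟩⟩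
  have hlift : ∀ c ∈ F, ∃ p, unbdd N ∘ p = some ∘ c.2 := fun c hc =>
    ⟨fun k => some ⟨c.2 k, hN c hc k⟩, rfl⟩
  have hinj : Function.Injective (unbdd (Γ := Γ) N ∘ · : (K → _) → _) :=
    (unbdd_injective N).comp_left
  have : Finite {l : List Γ // l.length ≤ N} := (List.finite_length_le Γ N).to_subtype
  refine exists_model (popBdd N) sys (fun q => {p | ∃ S, (q, S) ∈ F ∧ unbdd N ∘ p = some ∘ S})
    c₀.1 os (fun _ => none) ?_ ?_ ?_
  · rintro o q o' q' hr p ⟨S, hS, hp⟩ r h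
    obtain ⟨S', hS', h'⟩ := hrule o q o' q' hr S hS (unbdd N ∘ r) (by rw [← hp, pull_unbdd, h]; rfl)
    obtain ⟨p', hp'⟩ := hlift _ hS'
    refine ⟨p', ⟨S', hS', hp'⟩, Option.map_injective hinj ?_⟩
    rw [← pull_unbdd, hp', h']
    rfl
  · rintro o q hb p ⟨S, hS, hp⟩
    rw [← Option.map_eq_none_iff (f := (unbdd N ∘ ·)), ← pull_unbdd, hp]
    exact hbad o q hb S hS
  · intro r
    constructor
    · rintro ⟨p, ⟨S, hS, hp⟩, h⟩
      have h' : pulls pop os (some ∘ S) = some (unbdd N ∘ r) := by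
        rw [← hp, pulls_unbdd, h]
        rfl
      have hr := isSome_of_pulls (p := some ∘ S) (p' := some ∘ c₀.2) (fun _ => rfl) h' hos
      funext k
      have := hr k
      simpa [unbdd] using this
    · rintro rfl
      obtain ⟨p, hp⟩ := hlift _ hc₀
      refine ⟨p, ⟨_, hc₀, hp⟩, Option.map_injective hinj ?_⟩
      rw [← pulls_unbdd, hp, hos]
      rfl

end Bounded

section Micro

open Turing

variable {K Γ Λ σ : Type}

/-- The rules of the stack system that executes a machine one stack operation at a time. -/
inductive MicroRule (M : Λ → TM2.Stmt (fun _ : K => Γ) Λ σ) :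
    Option (K × Option Γ) → TM2.Stmt (fun _ : K => Γ) Λ σ × σ →
    Option (K × Option Γ) → TM2.Stmt (fun _ : K => Γ) Λ σ × σ → Prop
  | push (k f q v) : MicroRule M none (.push k f q, v) (some (k, some (f v))) (q, v)
  | peek (k f q v x) : MicroRule M (some (k, x)) (.peek k f q, v) (some (k, x)) (q, f v x)
  | pop (k f q v x) : MicroRule M (some (k, some x)) (.pop k f q, v) none (q, f v (some x))
  | popEmpty (k f q v) :
      MicroRule M (some (k, none)) (.pop k f q, v) (some (k, none)) (q, f v none)
  | load (a q v) : MicroRule M none (.load a q, v) none (q, a v)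
  | branch (f q₁ q₂ v) : MicroRule M none (.branch f q₁ q₂, v) none (cond (f v) q₁ q₂, v)
  | goto (l v) : MicroRule M none (.goto l, v) none (M (l v), v)

variable [DecidableEq K]

/-- Execution of a machine one stack operation at a time. -/
def micro (M : Λ → TM2.Stmt (fun _ : K => Γ) Λ σ) :
    (TM2.Stmt (fun _ : K => Γ) Λ σ × σ) × (K → List Γ) →
    Option ((TM2.Stmt (fun _ : K => Γ) Λ σ × σ) × (K → List Γ))
  | ((.push k f q, v), S) => some ((q, v), Function.update S k (f v :: S k))
  | ((.peek k f q, v), S) => some ((q, f v (S k).head?), S)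
  | ((.pop k f q, v), S) => some ((q, f v (S k).head?), Function.update S k (S k).tail)
  | ((.load a q, v), S) => some ((q, a v), S)
  | ((.branch f q₁ q₂, v), S) => some ((cond (f v) q₁ q₂, v), S)
  | ((.goto l, v), S) => some ((M (l v), v), S)
  | ((.halt, _), _) => none

theorem pull_pop_some_iff [DecidableEq Γ] {k : K} {y : Γ} {S : K → List Γ}
    {p : K → Option (List Γ)} : pull pop (some (k, some y)) (some ∘ S) = some p ↔
      ∃ l, S k = y :: l ∧ Function.update (some ∘ S) k (some l) = p := by
  simp only [pull, Function.comp_apply, Option.map_eq_some_iff]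
  rcases h : S k with _ | ⟨x, l⟩
  · simp [pop]
  · simp only [pop]
    grind

theorem pull_pop_none_iff [DecidableEq Γ] {k : K} {S : K → List Γ}
    {p : K → Option (List Γ)} : pull pop (some (k, none)) (some ∘ S) = some p ↔
      S k = [] ∧ Function.update (some ∘ S) k none = p := by
  simp only [pull, Function.comp_apply, Option.map_eq_some_iff]
  rcases h : S k with _ | ⟨x, l⟩ <;> simp [pop]

theorem update_comp_some (S : K → List Γ) (k : K) (l : List Γ) :
    Function.update (some ∘ S) k (some l) = some ∘ Function.update S k l :=
  (Function.comp_update some S k l).symm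

theorem head?_of_pull [DecidableEq Γ] {k : K} {x : Option Γ} {S : K → List Γ}
    {p : K → Option (List Γ)} (h : pull pop (some (k, x)) (some ∘ S) = some p) :
    (S k).head? = x := by
  rcases x with _ | x
  · rw [(pull_pop_none_iff.1 h).1, List.head?_nil]
  · obtain ⟨l, hl, -⟩ := pull_pop_some_iff.1 h
    rw [hl, List.head?_cons]

theorem exists_pull_head? [DecidableEq Γ] (k : K) (S : K → List Γ) :
    ∃ p, pull pop (some (k, (S k).head?)) (some ∘ S) = some p := by
  rcases h : S k with _ | ⟨x, l⟩
  · exact ⟨_, pull_pop_none_iff.2 ⟨h, rfl⟩⟩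
  · exact ⟨_, pull_pop_some_iff.2 ⟨l, h, rfl⟩⟩

variable {M : Λ → TM2.Stmt (fun _ : K => Γ) Λ σ}

theorem exists_rule_of_micro [DecidableEq Γ]
    {c c' : (TM2.Stmt (fun _ : K => Γ) Λ σ × σ) × (K → List Γ)} (h : micro M c = some c') :
    ∃ o o' p, MicroRule M o c.1 o' c'.1 ∧ pull pop o (some ∘ c.2) = some p ∧
      pull pop o' (some ∘ c'.2) = some p := by
  obtain ⟨⟨s, v⟩, S⟩ := c
  cases s <;> simp only [micro, Option.some.injEq, reduceCtorEq] at h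
  all_goals subst h
  case push k f q =>
    exact ⟨_, _, _, .push k f q v, rfl, pull_pop_some_iff.2 ⟨S k, Function.update_self .., by
      rw [update_comp_some, Function.update_idem, Function.update_eq_self]⟩⟩
  case peek k f q =>
    obtain ⟨p, hp⟩ := exists_pull_head? k S
    exact ⟨_, _, p, .peek k f q v _, hp, hp⟩
  case pop k f q =>
    rcases h : S k with _ | ⟨x, l⟩
    · refine ⟨_, _, _, .popEmpty k f q v, pull_pop_none_iff.2 ⟨h, rfl⟩, ?_⟩
      rw [List.tail_nil, ← h, Function.update_eq_self]
      exact pull_pop_none_iff.2 ⟨h, rfl⟩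
    · refine ⟨_, _, _, .pop k f q v x, pull_pop_some_iff.2 ⟨l, h, rfl⟩, ?_⟩
      rw [update_comp_some]
      rfl
  case load a q => exact ⟨_, _, _, .load a q v, rfl, rfl⟩
  case branch f q₁ q₂ => exact ⟨_, _, _, .branch f q₁ q₂ v, rfl, rfl⟩
  case goto l => exact ⟨_, _, _, .goto l v, rfl, rfl⟩

theorem exists_micro_of_rule [DecidableEq Γ] {o q o' q'} (hr : MicroRule M o q o' q')
    {S : K → List Γ} {p : K → Option (List Γ)} (hp : pull pop o (some ∘ S) = some p) :
    ∃ S', micro M (q, S) = some (q', S') ∧ pull pop o' (some ∘ S') = some p := by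
  cases hr with
  | push k f q v =>
    refine ⟨_, rfl, pull_pop_some_iff.2 ⟨S k, Function.update_self .., ?_⟩⟩
    rw [update_comp_some, Function.update_idem, Function.update_eq_self]
    exact Option.some.inj hp
  | peek k f q v x => exact ⟨S, by rw [micro, head?_of_pull hp], hp⟩
  | pop k f q v x =>
    obtain ⟨l, hl, rfl⟩ := pull_pop_some_iff.1 hp
    exact ⟨Function.update S k l, by rw [micro, hl]; rfl, by rw [update_comp_some]; rfl⟩
  | popEmpty k f q v =>
    have h := (pull_pop_none_iff.1 hp).1
    exact ⟨S, by rw [micro, h, List.tail_nil, ← h, Function.update_eq_self, h]; rfl, hp⟩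
  | load a q v => exact ⟨S, rfl, hp⟩
  | branch f q₁ q₂ v => exact ⟨S, rfl, hp⟩
  | goto l v => exact ⟨S, rfl, hp⟩

/-- The configurations reached by stack operations. -/
def MicroReaches (M : Λ → TM2.Stmt (fun _ : K => Γ) Λ σ) :
    (TM2.Stmt (fun _ : K => Γ) Λ σ × σ) × (K → List Γ) →
    (TM2.Stmt (fun _ : K => Γ) Λ σ × σ) × (K → List Γ) → Prop :=
  Relation.ReflTransGen fun c d => micro M c = some d

/-- The translation of configurations of a machine. -/
def microCfg (M : Λ → TM2.Stmt (fun _ : K => Γ) Λ σ) (c : TM2.Cfg (fun _ : K => Γ) Λ σ) :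
    (TM2.Stmt (fun _ : K => Γ) Λ σ × σ) × (K → List Γ) :=
  ((c.l.elim .halt M, c.var), c.stk)

theorem microReaches_stepAux (s : TM2.Stmt (fun _ : K => Γ) Λ σ) (v : σ) (S : K → List Γ) :
    MicroReaches M ((s, v), S) (microCfg M (TM2.stepAux s v S)) := by
  induction s generalizing v S with
  | push k f q ih => exact .head rfl (ih _ _)
  | peek k f q ih => exact .head rfl (ih _ _)
  | pop k f q ih => exact .head rfl (ih _ _)
  | load a q ih => exact .head rfl (ih _ _)
  | branch f q₁ q₂ ih₁ ih₂ =>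
    refine .head rfl ?_
    rw [TM2.stepAux]
    cases f v
    exacts [ih₂ _ _, ih₁ _ _]
  | goto l => exact .head rfl .refl
  | halt => exact .refl

theorem microReaches_of_reaches {c c' : TM2.Cfg (fun _ : K => Γ) Λ σ}
    (h : StateTransition.Reaches (TM2.step M) c c') :
    MicroReaches M (microCfg M c) (microCfg M c') := by
  induction h with
  | refl => exact .refl
  | @tail c₁ c₂ _ h ih =>
    refine ih.trans ?_
    obtain ⟨_ | l, v, S⟩ := c₁
    · cases h
    · cases h
      exact microReaches_stepAux _ _ _

theorem finite_microReaches {c t} (h : MicroReaches M c t) (ht : micro M t = none) :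
    {c' | MicroReaches M c c'}.Finite := by
  induction h using Relation.ReflTransGen.head_induction_on with
  | refl =>
    refine (Set.finite_singleton t).subset fun c' hc' => ?_
    rcases hc'.cases_head with rfl | ⟨d, hd, -⟩
    · rfl
    · rw [ht] at hd
      cases hd
  | @head a b hab _ ih =>
    refine (ih.insert a).subset fun c' hc' => ?_
    rcases hc'.cases_head with rfl | ⟨d, hd, hdc⟩
    · exact .inl rfl
    · rw [hab] at hd
      cases hd
      exact .inr hdc

theorem eq_of_microReaches {c t t'} (h : MicroReaches M c t) (ht : micro M t = none)
    (h' : MicroReaches M c t') (ht' : micro M t' = none) : t = t' := by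
  have hu : Relator.RightUnique fun c c' => micro M c = some c' := fun a b c hb hc =>
    Option.some.inj (hb.symm.trans hc)
  rcases Relation.ReflTransGen.total_of_right_unique hu h h' with h | h <;>
    rcases h.cases_head with h | ⟨d, hd, -⟩
  · exact h
  · rw [ht] at hd
    cases hd
  · exact h.symm
  · rw [ht'] at hd
    cases hd

end Micro

section Machine

open Turing

variable {K Γ Λ σ : Type}

/-- The states of a machine executed one stack operation at a time: statements inside the programs
of the labels in `T`, with a value of the internal store. -/
def MachineState (M : Λ → TM2.Stmt (fun _ : K => Γ) Λ σ) (T : Finset Λ) : Type :=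
  {q : TM2.Stmt (fun _ : K => Γ) Λ σ × σ // some q.1 ∈ TM2.stmts M T}

theorem finite_machineState [Finite σ] (M : Λ → TM2.Stmt (fun _ : K => Γ) Λ σ) (T : Finset Λ) :
    Finite (MachineState M T) := by
  refine Finite.of_injective (β := TM2.stmts M T × σ) (fun q => (⟨_, q.2⟩, q.1.2)) ?_
  rintro ⟨⟨s, v⟩, h⟩ ⟨⟨s', v'⟩, h'⟩ e
  exact Subtype.ext (by simpa using e)

/-- The stack system executing a machine; halting with `o` applicable is forbidden. -/
def machineSystem (M : Λ → TM2.Stmt (fun _ : K => Γ) Λ σ) (T : Finset Λ) (o : K × Option Γ) :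
    StackSystem K Γ (MachineState M T) where
  rule o q o' q' := MicroRule M o q.1 o' q'.1
  bad o' q := o' = some o ∧ q.1.1 = .halt

variable {M : Λ → TM2.Stmt (fun _ : K => Γ) Λ σ} {T : Finset Λ}

theorem MicroRule.mem_stmts (hT : ∀ l ∈ T, TM2.SupportsStmt T (M l)) {o q o' q'}
    (h : MicroRule M o q o' q') (hq : some q.1 ∈ TM2.stmts M T) :
    some q'.1 ∈ TM2.stmts M T := by
  classical
  cases h with
  | branch f q₁ q₂ v =>
    refine TM2.stmts_trans ?_ hq
    cases f v <;> simp [TM2.stmts₁, TM2.stmts₁_self]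
  | goto l v =>
    simp only [TM2.stmts, Finset.mem_insertNone, Finset.mem_biUnion, Option.mem_def,
      Option.some.injEq, forall_eq'] at hq ⊢
    obtain ⟨l', hl', h⟩ := hq
    exact ⟨_, TM2.stmts₁_supportsStmt_mono h (hT l' hl') v, TM2.stmts₁_self⟩
  | _ => exact TM2.stmts_trans (Finset.mem_insert_of_mem TM2.stmts₁_self) hq

variable [DecidableEq K] [DecidableEq Γ]

theorem exists_reflTransGen_step (hT : ∀ l ∈ T, TM2.SupportsStmt T (M l)) (o : K × Option Γ)
    (q : MachineState M T) (S : K → List Γ) {t} (h : MicroReaches M (q.1, S) t) :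
    ∃ q' : MachineState M T, q'.1 = t.1 ∧
      Relation.ReflTransGen (machineSystem M T o).Step (q, S) (q', t.2) := by
  induction h with
  | refl => exact ⟨q, rfl, .refl⟩
  | tail _ h ih =>
    obtain ⟨q', hq', hr⟩ := ih
    obtain ⟨o₁, o₂, p, hm, h₁, h₂⟩ := exists_rule_of_micro h
    rw [← hq'] at hm
    exact ⟨⟨_, hm.mem_stmts hT q'.2⟩, rfl, hr.tail ⟨o₁, o₂, p, hm, h₁, h₂⟩⟩

theorem exists_model_of_halts [Finite K] [Finite Γ] {o : K × Option Γ} {q : MachineState M T}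
    {S : K → List Γ} {t} (h : MicroReaches M (q.1, S) t) (ht : micro M t = none)
    (ho : pull pop (some o) (some ∘ t.2) = none) {os}
    (hos : pulls pop os (some ∘ S) = some fun _ => none) :
    ∃ (L : Type) (_ : Lattice L) (_ : IsModularLattice L) (_ : Finite L)
      (v : Var K Γ (MachineState M T) → L), (machineSystem M T o).Models v ∧
        v .goal = (stackTerm os (.var (.st q))).eval v ∧ v .goal ≠ v .bot := by
  refine exists_model_of_finite (machineSystem M T o) (c₀ := (q, S))
    (F := {c | MicroReaches M (q.1, S) (c.1.1, c.2)}) ?_ .refl hos ?_ ?_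
  · refine (finite_microReaches h ht).preimage
      (f := fun c : MachineState M T × (K → List Γ) => (c.1.1, c.2)) fun c _ c' _ e => ?_
    obtain ⟨c₁, c₂⟩ := c
    obtain ⟨c₁', c₂'⟩ := c'
    simp only [Prod.mk.injEq] at e
    rw [Subtype.ext e.1, e.2]
  · rintro o₁ q₁ o₂ q₂ hr S₁ hS₁ p hp
    obtain ⟨S₂, hm, hp'⟩ := exists_micro_of_rule hr hp
    exact ⟨S₂, Relation.ReflTransGen.tail hS₁ hm, hp'⟩
  · rintro _ ⟨⟨s, v⟩, hs⟩ ⟨rfl, rfl : s = _⟩ S₁ hS₁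
    rw [eq_of_microReaches h ht hS₁ rfl] at ho
    exact ho

end Machine

section Code

open Turing PartrecToTM2

instance : Fintype K' :=
  ⟨{.main, .rev, .aux, .stack}, fun k => by cases k <;> simp⟩

instance (c : ToPartrec.Code) : Finite (MachineState tr (codeSupp c .halt)) :=
  finite_machineState tr _

/-- The stack system executing a program; halting with `1` on top is forbidden. -/
noncomputable def codeSystem (c : ToPartrec.Code) :
    StackSystem K' Γ' (MachineState tr (codeSupp c .halt)) :=
  machineSystem tr (codeSupp c .halt) (.main, some .bit1)

/-- The initial state of a program. -/
noncomputable def codeStart (c : ToPartrec.Code) : MachineState tr (codeSupp c .halt) :=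
  ⟨(tr (trNormal c .halt), none), by
    simp only [TM2.stmts, Finset.mem_insertNone, Finset.mem_biUnion, Option.mem_def]
    rintro _ ⟨⟩
    exact ⟨_, (tr_supports c .halt).1, TM2.stmts₁_self⟩⟩

/-- The stack operations removing what remains of the input `2 ^ n` after its zeros. -/
def closingOps : List (K' × Option Γ') :=
  [(.main, some .bit1), (.main, some .cons), (.main, none), (.rev, none), (.aux, none),
    (.stack, none)]

/-- The stack operations removing the input `2 ^ n`. -/
def inputOps (n : ℕ) : List (K' × Option Γ') :=
  List.replicate n (.main, some .bit0) ++ closingOps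

theorem trNum_bit0 {m : Num} (hm : m ≠ 0) : trNum m.bit0 = .bit0 :: trNum m := by
  cases m with
  | zero => exact absurd rfl hm
  | pos m => rfl

theorem trNat_two_pow (n : ℕ) : trNat (2 ^ n) = List.replicate n .bit0 ++ [.bit1] := by
  induction n with
  | zero => simp [trNat, trNum, trPosNum]
  | succ n ih =>
    have h : ((2 ^ (n + 1) : ℕ) : Num) = Num.bit0 ((2 ^ n : ℕ) : Num) := by
      rw [← Num.to_nat_inj, Num.to_of_nat, Num.cast_bit0, Num.to_of_nat, pow_succ', two_mul]
    have h0 : ((2 ^ n : ℕ) : Num) ≠ 0 := by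
      rw [ne_eq, ← Num.to_nat_inj, Num.to_of_nat]
      simp
    rw [trNat, h, trNum_bit0 h0, List.replicate_succ, List.cons_append, ← ih]
    rfl

theorem pulls_cons {K X S : Type} [DecidableEq K] {pop : X → S → Option S} {o : K × X}
    {os : List (K × X)} {p p' : K → S} (h : pull pop (some o) p = some p') :
    pulls pop (o :: os) p = pulls pop os p' := by
  rw [pulls, List.foldlM_cons, h]
  rfl

theorem pulls_inputOps (n : ℕ) :
    pulls pop (inputOps n) (some ∘ K'.elim (trList [2 ^ n]) [] [] []) = some fun _ => none := by
  rw [trList, trList, trNat_two_pow, List.append_assoc, List.singleton_append]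
  induction n with
  | zero =>
    decide
  | succ n ih =>
    rw [← ih]
    refine pulls_cons (pull_pop_some_iff.2 ⟨_, rfl, ?_⟩)
    rw [update_comp_some, K'.elim_update_main]
    rfl

theorem microReaches_of_mem_eval {c : ToPartrec.Code} {v w : List ℕ} (h : w ∈ c.eval v) :
    MicroReaches tr ((codeStart c).1, K'.elim (trList v) [] [] [])
      ((.halt, none), K'.elim (trList w) [] [] []) := by
  have h' : PartrecToTM2.halt w ∈ StateTransition.eval (TM2.step tr) (init c v) := by
    rw [tr_eval]
    exact Part.mem_map _ h
  exact microReaches_of_reaches (StateTransition.mem_eval.1 h').1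

theorem eq_bot_of_mem_eval {c : ToPartrec.Code} {n : ℕ} (h : [1] ∈ c.eval [2 ^ n])
    {L : Type} [Lattice L] [IsModularLattice L] [Finite L]
    {v : Var K' Γ' (MachineState tr (codeSupp c .halt)) → L} (hv : (codeSystem c).Models v)
    (hg : v .goal = (stackTerm (inputOps n) (.var (.st (codeStart c)))).eval v) (x) :
    v x = v .bot := by
  obtain ⟨q, hq, hr⟩ := exists_reflTransGen_step (tr_supports c .halt).2 (.main, some .bit1)
    (codeStart c) _ (microReaches_of_mem_eval h)
  refine hv.eq_bot_of_reaches_bad hg (c := (codeStart c, _)) (pulls_inputOps n) hr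
    (o := some (.main, some .bit1)) ⟨rfl, by rw [hq]⟩ (pull_pop_some_iff.2 ⟨[.cons], rfl, rfl⟩) x

theorem exists_model_of_mem_eval {c : ToPartrec.Code} {n : ℕ} (h : [0] ∈ c.eval [2 ^ n]) :
    ∃ (L : Type) (_ : Lattice L) (_ : IsModularLattice L) (_ : Finite L)
      (v : Var K' Γ' (MachineState tr (codeSupp c .halt)) → L), (codeSystem c).Models v ∧
        v .goal = (stackTerm (inputOps n) (.var (.st (codeStart c)))).eval v ∧
        v .goal ≠ v .bot :=
  exists_model_of_halts (microReaches_of_mem_eval h) rfl (by decide) (pulls_inputOps n)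

end Code

section Coding

variable {V : Type}

theorem mem_vars_conj {Φ : LatConj} {i : ℕ} :
    i ∈ Φ.vars ↔ ∃ p ∈ Φ, i ∈ p.1.vars ∨ i ∈ p.2.vars := by
  rw [LatConj.vars]
  induction Φ with
  | nil => simp
  | cons p Φ ih =>
    rw [List.foldr_cons, Finset.mem_union, ih, Finset.mem_union, List.exists_mem_cons_iff]

/-- Renaming of variables into `ℕ` in a list of equations. -/
def toConj (f : V → ℕ) (E : List (Term V × Term V)) : LatConj :=
  E.map fun p => (p.1.toLatTerm f, p.2.toLatTerm f)

theorem sat_toConj {L : Type} [Lattice L] {f : V → ℕ} {E : List (Term V × Term V)} {v : ℕ → L} :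
    (toConj f E).Sat v ↔ ∀ p ∈ E, p.1.eval (v ∘ f) = p.2.eval (v ∘ f) := by
  simp only [LatConj.Sat, toConj, List.forall_mem_map, Term.eval_toLatTerm]

theorem exists_of_mem_vars_toConj {f : V → ℕ} {E : List (Term V × Term V)} {i : ℕ}
    (hi : i ∈ (toConj f E).vars) : ∃ x, f x = i := by
  obtain ⟨_, hp, hi⟩ := mem_vars_conj.1 hi
  obtain ⟨p, -, rfl⟩ := List.mem_map.1 hp
  rcases hi with hi | hi <;> exact Term.exists_of_mem_vars_toLatTerm f _ hi

variable {K Γ Q : Type} {f : Var K Γ Q → ℕ}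

theorem primrec_code_actTerm (f : Var K Γ Q → ℕ) (o : Op K Γ) :
    ∃ F : ℕ → ℕ, Primrec F ∧
      ∀ t, ((actTerm o t).toLatTerm f).code = F ((t.toLatTerm f).code) := by
  have h (c d : ℕ) : Primrec fun m => 3 * Nat.pair m c + d :=
    Primrec.nat_add.comp (Primrec.nat_mul.comp (.const 3)
      (Primrec₂.natPair.comp .id (.const c))) (.const d)
  exact ⟨_, (h (3 * f .a) 2).comp ((h (3 * f (.op .one)) 1).comp
    ((h (3 * f .b) 2).comp (h (3 * f (.op o)) 1))), fun t => rfl⟩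

theorem primrec_code_stackTerm (os : List (K × Option Γ)) {g : ℕ → Term (Var K Γ Q)}
    (hg : Primrec fun n => ((g n).toLatTerm f).code) :
    Primrec fun n => ((stackTerm os (g n)).toLatTerm f).code := by
  induction os generalizing g with
  | nil => exact hg
  | cons o os ih =>
    refine ih (g := fun n => actTerm (.stk o.1 o.2) (g n)) ?_
    obtain ⟨F, hF, h⟩ := primrec_code_actTerm f (.stk o.1 o.2)
    simp only [h]
    exact hF.comp hg

theorem primrec_code_stackTerm_replicate (o : K × Option Γ) (t : Term (Var K Γ Q)) :
    Primrec fun n => ((stackTerm (List.replicate n o) t).toLatTerm f).code := by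
  obtain ⟨F, hF, h⟩ := primrec_code_actTerm f (.stk o.1 o.2)
  refine (Primrec.nat_iterate .id (.const (t.toLatTerm f).code)
    (hF.comp .snd).to₂ : Primrec fun n => F^[n] (t.toLatTerm f).code).of_eq fun n => ?_
  induction n generalizing t with
  | zero => rfl
  | succ n ih => rw [Function.iterate_succ_apply, ← h, ih]; rfl

end Coding

section Reduction

open Turing PartrecToTM2

/-- A list of all equations of the stack system of a program. -/
noncomputable def codeEqns (c : ToPartrec.Code) :
    List (Term (Var K' Γ' (MachineState tr (codeSupp c .halt))) ×
      Term (Var K' Γ' (MachineState tr (codeSupp c .halt)))) :=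
  (Set.finite_range (codeSystem c).eqn).toFinset.toList

theorem forall_mem_codeEqns {c : ToPartrec.Code} {L : Type} [Lattice L]
    {v : Var K' Γ' (MachineState tr (codeSupp c .halt)) → L} :
    (∀ p ∈ codeEqns c, p.1.eval v = p.2.eval v) ↔ (codeSystem c).Models v := by
  simp [codeEqns, StackSystem.Models]

/-- The equations stating that a program run on `2 ^ n` does not halt with output `1`. -/
noncomputable def haltConj (c : ToPartrec.Code)
    (f : Var K' Γ' (MachineState tr (codeSupp c .halt)) → ℕ) (n : ℕ) : LatConj :=
  toConj f ((.var .goal, stackTerm (inputOps n) (.var (.st (codeStart c)))) :: codeEqns c)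

variable {c : ToPartrec.Code} {f : Var K' Γ' (MachineState tr (codeSupp c .halt)) → ℕ}

theorem primrec_code_haltConj : Primrec fun n => (haltConj c f n).code := by
  have h : Primrec fun n =>
      ((stackTerm (inputOps n) (.var (.st (codeStart c)))).toLatTerm f).code := by
    simp only [inputOps, stackTerm, List.foldl_append]
    exact primrec_code_stackTerm closingOps (primrec_code_stackTerm_replicate _ _)
  exact Primrec.encode.comp (Primrec.list_cons.comp
    (Primrec₂.natPair.comp (.const ((Term.var .goal).toLatTerm f).code) h)
    (.const ((toConj f (codeEqns c)).map fun p => Nat.pair p.1.code p.2.code)))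

theorem sat_haltConj {n : ℕ} {L : Type} [Lattice L] {v : ℕ → L} :
    (haltConj c f n).Sat v ↔
      (v ∘ f) .goal = (stackTerm (inputOps n) (.var (.st (codeStart c)))).eval (v ∘ f) ∧
        (codeSystem c).Models (v ∘ f) := by
  rw [haltConj, sat_toConj, List.forall_mem_cons, forall_mem_codeEqns]
  rfl

theorem not_nontriv_haltConj {n : ℕ} (h : [1] ∈ c.eval [2 ^ n]) {L : Type} [Lattice L]
    [IsModularLattice L] [Finite L] {v : ℕ → L} (hv : (haltConj c f n).Sat v) :
    ¬ (haltConj c f n).Nontriv v := by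
  obtain ⟨hg, hv⟩ := sat_haltConj.1 hv
  rintro ⟨i, hi, j, hj, hij⟩
  obtain ⟨x, rfl⟩ := exists_of_mem_vars_toConj hi
  obtain ⟨y, rfl⟩ := exists_of_mem_vars_toConj hj
  exact hij ((eq_bot_of_mem_eval h hv hg x).trans (eq_bot_of_mem_eval h hv hg y).symm)

theorem exists_sat_nontriv_haltConj (hf : f.Injective) {n : ℕ} (h : [0] ∈ c.eval [2 ^ n]) :
    ∃ (L : Type) (_ : Lattice L) (_ : IsModularLattice L) (_ : Finite L) (v : ℕ → L),
      (haltConj c f n).Sat v ∧ (haltConj c f n).Nontriv v := by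
  obtain ⟨L, _, hL, hfin, v, hv, hg, hne⟩ := exists_model_of_mem_eval h
  have he : Function.extend f v (fun _ => v .bot) ∘ f = v := Function.extend_comp hf v _
  refine ⟨L, _, hL, hfin, Function.extend f v fun _ => v .bot, ?_, f .goal, ?_, f .bot, ?_, ?_⟩
  · rw [sat_haltConj, he]
    exact ⟨hg, hv⟩
  · exact mem_vars_conj.2 ⟨_, List.mem_cons_self, .inl (Finset.mem_singleton_self _)⟩
  · refine mem_vars_conj.2 ⟨_, List.mem_map.2
      ⟨(codeSystem c).eqn (.lower .goal), List.mem_cons_of_mem _ ?_, rfl⟩, .inl ?_⟩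
    · simp [codeEqns]
    · exact Finset.mem_union_left _ (Finset.mem_singleton_self _)
  · rwa [hf.extend_apply, hf.extend_apply]

/-- A program evaluating the `e`-th partial recursive function at `e`, on the input `2 ^ e`. -/
theorem exists_diagonal_code : ∃ c : ToPartrec.Code, ∀ e : ℕ,
    c.eval [2 ^ e] = pure <$> (Denumerable.ofNat Nat.Partrec.Code e).eval e := by
  let l (m : ℕ) : ℕ := m.findGreatest fun k => 2 ^ k ≤ m
  have hl : Primrec l := by
    refine Primrec.nat_findGreatest .id (Primrec.nat_le.comp ?_ .fst)
    exact (Primrec₂.unpaired'.1 Nat.Primrec.pow).comp (.const 2) .snd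
  have hle (e : ℕ) : l (2 ^ e) = e := by
    refine Nat.findGreatest_eq_iff.2 ⟨Nat.lt_two_pow_self.le, fun _ => le_rfl, fun k hk _ h => ?_⟩
    exact absurd ((Nat.pow_le_pow_iff_right Nat.one_lt_two).1 h) hk.not_ge
  have hp : Partrec fun m => (Denumerable.ofNat Nat.Partrec.Code (l m)).eval (l m) :=
    Nat.Partrec.Code.eval_part.comp ((Computable.ofNat _).comp hl.to_comp) hl.to_comp
  obtain ⟨c, hc⟩ := ToPartrec.Code.exists_code (Nat.Partrec'.part_iff₁.2 hp)
  refine ⟨c, fun e => ?_⟩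
  have := hc ⟨[2 ^ e], rfl⟩
  rw [List.Vector.head] at this
  rw [this, hle]

end Reduction

end ModularConsistency

/-- The consistency problem for the class of all finite modular
lattices is unsolvable: no computable function decides (via the Gödel numbering
`LatConj.code`) whether a conjunction of lattice equations admits a non-trivial
satisfying assignment in some finite modular lattice. -/
theorem finite_modular_lattice_consistency_undecidable :
    ¬ ∃ f : ℕ → Bool, Computable f ∧
      ∀ Φ : LatConj, (f Φ.code = true ↔
        ∃ (L : Type) (_ : Lattice L) (_ : IsModularLattice L) (_ : Finite L)
          (v : ℕ → L), Φ.Sat v ∧ Φ.Nontriv v) := by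
  open ModularConsistency Turing PartrecToTM2 in
  rintro ⟨d, hd, hΦ⟩
  obtain ⟨c, hc⟩ := exists_diagonal_code
  obtain ⟨f, hf⟩ := exists_injective_nat (Var K' Γ' (MachineState tr (codeSupp c .halt)))
  have hcomp : Computable fun n => cond (d (haltConj c f n).code) 1 0 :=
    Computable.cond (hd.comp primrec_code_haltConj.to_comp) (.const 1) (.const 0)
  obtain ⟨p, hp⟩ := Nat.Partrec.Code.exists_code.1 (Partrec.nat_iff.1 hcomp.partrec)
  have he := hc (Encodable.encode p)
  rw [Denumerable.ofNat_encode, hp] at he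
  cases hb : d (haltConj c f (Encodable.encode p)).code with
  | true =>
    obtain ⟨L, _, _, _, v, hv, hn⟩ := (hΦ _).1 hb
    refine not_nontriv_haltConj (c := c) ?_ hv hn
    rw [he]
    simp [hb]
  | false =>
    refine absurd ((hΦ _).2 (exists_sat_nontriv_haltConj hf ?_)) (hb ▸ Bool.false_ne_true)
    rw [he]
    simp [hb]
end
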